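/- arXiv:math/0203028 — 4 statements merged into one kernel-verified Lean document; each statement's English description precedes it below -/
import Mathlib

section
/- Let m ≥ 2, k ≥ 2, and let α = (a₁/n, a₂/n, …, a_k/n) where a₁,…,a_k are positive integers with a₁ + ⋯ + a_k = n. Suppose that there does not exist a continuous D_{2n}-equivariant map F : V₂(ℝ³) → M(α). Then for every collection μ₁,…,μ_m of proper Borel probability measures on S² there exists a k-fan (x; l₁,…,l_k) whose sectors satisfy μ_j(σ_i) = a_i/n for all i = 1,…,k and j = 1,…,m. -/
/- STATEMENT 2 (Bárány–Matoušek reduction): if there is no continuous D_{2n}-equivariant map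
F : V₂(ℝ³) → M(α), α = (a₁/n,…,a_k/n), then every m proper Borel probability measures on S²
admit a simultaneous α-partition by a k-fan. -/

open MeasureTheory Real

noncomputable section

/-- ℝ³. -/
abbrev V3 : Type := Fin 3 → ℝ

/-- The cross product on ℝ³. -/
def cross (u v : V3) : V3 :=
  ![u 1 * v 2 - u 2 * v 1, u 2 * v 0 - u 0 * v 2, u 0 * v 1 - u 1 * v 0]

/-- The unit sphere S² ⊂ ℝ³. -/
abbrev Sph : Type := {p : V3 // ∑ i, p i * p i = 1}

/-- `(x, y)` is an orthonormal 2-frame in ℝ³. -/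
def IsFrame (x y : V3) : Prop :=
  (∑ i, x i * x i = 1) ∧ (∑ i, y i * y i = 1) ∧ (∑ i, x i * y i = 0)

/-- Rotation of the tangent vector `y` at `x` counterclockwise through an angle `t`. -/
def dir (x y : V3) (t : ℝ) : V3 := Real.cos t • y + Real.sin t • cross x y

/-- The open angular sector with apex `x` between the great semicircles with initial
directions `dir x y α` and `dir x y β`, swept counterclockwise. -/
def sector (x y : V3) (α β : ℝ) : Set V3 :=
  {p | ∃ s ∈ Set.Ioo (0 : ℝ) Real.pi, ∃ t ∈ Set.Ioo α β,
    p = Real.cos s • x + Real.sin s • dir x y t}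

/-- The angle bounding the `i`-th sector of a fan on the other side: the next angle
cyclically (after the last one, the first angle plus 2π). -/
def θnext {k : ℕ} (θ : Fin k → ℝ) (i : Fin k) : ℝ :=
  if h : (i : ℕ) + 1 < k then θ ⟨(i : ℕ) + 1, h⟩
  else θ ⟨0, Nat.lt_of_le_of_lt (Nat.zero_le _) i.isLt⟩ + 2 * Real.pi

/-- A Borel measure on S² is proper: circles (hence circular arcs) are null and nonempty
open sets have positive measure. -/
def Proper (μ : Measure Sph) : Prop :=
  (∀ c : V3, c ≠ 0 → ∀ d : ℝ, μ {p : Sph | ∑ i, (p : V3) i * c i = d} = 0) ∧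
  (∀ U : Set Sph, IsOpen U → U.Nonempty → 0 < μ U)

/-- Mat = (ℝ^{m−1})ⁿ, columns indexed cyclically by ZMod n. -/
abbrev Mat (n m : ℕ) : Type := ZMod n → (Fin (m - 1) → ℝ)

/-- Index permutation realizing the dihedral action: `E = r 1` shifts cyclically,
`J = sr 0` reverses. -/
def dperm {n : ℕ} : DihedralGroup n → ZMod n → ZMod n
  | DihedralGroup.r i => fun t => t + i
  | DihedralGroup.sr i => fun t => i - 1 - t

/-- The (left, linear) action of D_{2n} on n-tuples. -/
def dAct {n : ℕ} {α : Type*} (g : DihedralGroup n) (x : ZMod n → α) : ZMod n → α :=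
  fun t => x (dperm g t)

/-- Partial sums a₁ + ⋯ + a_j of the block sizes. -/
def psum {k : ℕ} (a : Fin k → ℕ) (j : Fin k) : ℕ :=
  ∑ i ∈ Finset.univ.filter (fun i => i < j), a i

/-- L(α): the subspace of W on which all k consecutive block sums of columns vanish. -/
def Lset (n m : ℕ) {k : ℕ} (a : Fin k → ℕ) [NeZero n] : Set (Mat n m) :=
  {x | (∑ i, x i = 0) ∧
    ∀ j : Fin k, (∑ i ∈ Finset.Ico (psum a j) (psum a j + a j), x (i : ZMod n)) = 0}

/-- M(α) = W ∖ ⋃_{g ∈ D_{2n}} g·L(α). -/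
def Mset (n m : ℕ) {k : ℕ} (a : Fin k → ℕ) [NeZero n] : Set (Mat n m) :=
  {x | (∑ i, x i = 0) ∧ ∀ g : DihedralGroup n, dAct g x ∉ Lset n m a}

/-- The Stiefel manifold V₂(ℝ³) of orthonormal 2-frames, as a subset of ℝ³ × ℝ³. -/
def StP : Set (V3 × V3) :=
  {v | (∑ i, v.1 i * v.1 i = 1) ∧ (∑ i, v.2 i * v.2 i = 1) ∧ (∑ i, v.1 i * v.2 i = 0)}

/-- The free D_{2n}-action on V₂(ℝ³): `r k` rotates `y` around `x` through 2πk/n, and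
`sr k` moreover replaces `x` by `−x` (so `E·(x,y) = (x, cos(2π/n)y + sin(2π/n)(x×y))`
and `J·(x,y) = (−x,y)`). -/
def stAct (n : ℕ) : DihedralGroup n → V3 × V3 → V3 × V3
  | DihedralGroup.r k => fun v => (v.1, dir v.1 v.2 (2 * Real.pi * (k.val : ℝ) / n))
  | DihedralGroup.sr k => fun v => (-v.1, dir v.1 v.2 (2 * Real.pi * (k.val : ℝ) / n))

/-- Complex coordinate of `p` in the plane orthogonal to the apex of the frame. -/
def wc (v : V3 × V3) (p : V3) : ℂ :=
  ⟨∑ i, p i * v.2 i, ∑ i, p i * cross v.1 v.2 i⟩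

/-- The unit complex number `exp (-i t)`, by components. -/
def rotc (t : ℝ) : ℂ := ⟨Real.cos t, -Real.sin t⟩

/-- Polar form `exp (i t)`. -/
def ec (t : ℝ) : ℂ := ⟨Real.cos t, Real.sin t⟩

/-- The integrand of the angular distribution function. -/
def ph (v : V3 × V3) (t : ℝ) (p : V3) : ℝ := Complex.arg (-(rotc t * wc v p))

/-- The canonical (mean-normalised) angular distribution function. -/
def PP (μ : Measure Sph) (v : V3 × V3) (t : ℝ) : ℝ := t + ∫ p : Sph, ph v t p.1 ∂μ

lemma cross_continuous : Continuous (fun v : V3 × V3 => cross v.1 v.2) := by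
  unfold cross
  refine continuous_pi fun i => ?_
  fin_cases i <;> simp <;> fun_prop

lemma wc_continuous : Continuous (fun q : (V3 × V3) × V3 => wc q.1 q.2) := by
  have h1 : Continuous (fun q : (V3 × V3) × V3 => cross q.1.1 q.1.2) :=
    cross_continuous.comp continuous_fst
  have h : (fun q : (V3 × V3) × V3 => wc q.1 q.2) = fun q =>
      ((∑ i, q.2 i * q.1.2 i : ℝ) : ℂ) + ((∑ i, q.2 i * cross q.1.1 q.1.2 i : ℝ) : ℂ) * Complex.I := by
    funext q
    apply Complex.ext <;> simp [wc]
  rw [h]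
  fun_prop

lemma rotc_continuous : Continuous rotc := by
  have h : rotc = fun t => ((Real.cos t : ℝ) : ℂ) - ((Real.sin t : ℝ) : ℂ) * Complex.I := by
    funext q
    apply Complex.ext <;> simp [rotc, -Complex.ofReal_sin, -Complex.ofReal_cos]
  rw [h]
  fun_prop

lemma rotc_add (s t : ℝ) : rotc (s + t) = rotc s * rotc t := by
  apply Complex.ext <;> simp [rotc, Real.cos_add, Real.sin_add, sub_eq_add_neg, add_comm]

lemma rotc_ec (s t : ℝ) : rotc s * ec t = ec (t - s) := by
  apply Complex.ext <;> simp [rotc, ec, Real.cos_sub, Real.sin_sub] <;> ring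

lemma ec_sub_pi (s : ℝ) : ec (s - π) = - ec s := by
  apply Complex.ext <;> simp [ec]

lemma ec_add_pi (s : ℝ) : ec (s + π) = - ec s := by
  apply Complex.ext <;> simp [ec]

lemma arg_ec (r s : ℝ) (hr : 0 < r) (hs : s ∈ Set.Ioc (-π) π) :
    Complex.arg (r * ec s) = s := by
  have : ec s = Complex.cos s + Complex.sin s * Complex.I := by
    apply Complex.ext <;> simp [ec, ← Complex.ofReal_cos, ← Complex.ofReal_sin]
  rw [this, Complex.arg_mul_cos_add_sin_mul_I hr hs]

lemma polar (w : ℂ) : w = (‖w‖ : ℂ) * ec w.arg := by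
  have : ec w.arg = Complex.cos w.arg + Complex.sin w.arg * Complex.I := by
    apply Complex.ext <;> simp [ec, ← Complex.ofReal_cos, ← Complex.ofReal_sin]
  rw [this, Complex.norm_mul_cos_add_sin_mul_I]

lemma cross_cross_frame (v : V3 × V3) (hv : v ∈ StP) (i : Fin 3) :
    cross v.1 (cross v.1 v.2) i = - v.2 i := by
  obtain ⟨h1, h2, h3⟩ := hv
  simp only [Fin.sum_univ_three] at h1 h2 h3
  fin_cases i
  · simp [cross]; linear_combination v.1 0 * h3 - v.2 0 * h1
  · simp [cross]; linear_combination v.1 1 * h3 - v.2 1 * h1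
  · simp [cross]; linear_combination v.1 2 * h3 - v.2 2 * h1

lemma cross_dir (v : V3 × V3) (hv : v ∈ StP) (s : ℝ) (i : Fin 3) :
    cross v.1 (dir v.1 v.2 s) i = Real.cos s * cross v.1 v.2 i - Real.sin s * v.2 i := by
  have h := cross_cross_frame v hv i
  have : cross v.1 (dir v.1 v.2 s) i = Real.cos s * cross v.1 v.2 i
      + Real.sin s * cross v.1 (cross v.1 v.2) i := by
    unfold dir
    fin_cases i <;> simp [cross] <;> ring
  rw [this, h]; ring

lemma wc_rot (v : V3 × V3) (hv : v ∈ StP) (s : ℝ) (p : V3) :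
    wc (v.1, dir v.1 v.2 s) p = rotc s * wc v p := by
  apply Complex.ext
  · simp [wc, rotc, dir, cross, Fin.sum_univ_three]; ring
  · simp only [wc, rotc, cross_dir v hv, Fin.sum_univ_three, Complex.mul_im]; ring

lemma wc_flip (v : V3 × V3) (p : V3) :
    wc (-v.1, v.2) p = (starRingEnd ℂ) (wc v p) := by
  apply Complex.ext
  · simp [wc]
  · simp [wc, cross, Fin.sum_univ_three]; ring

lemma frame_z (v : V3 × V3) (hv : v ∈ StP) :
    (∑ i, cross v.1 v.2 i * cross v.1 v.2 i = 1) ∧ (∑ i, v.1 i * cross v.1 v.2 i = 0) ∧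
      (∑ i, v.2 i * cross v.1 v.2 i = 0) := by
  obtain ⟨h1, h2, h3⟩ := hv
  simp only [Fin.sum_univ_three] at h1 h2 h3 ⊢
  refine ⟨?_, ?_, ?_⟩
  · simp [cross]
    linear_combination (v.2 0 * v.2 0 + v.2 1 * v.2 1 + v.2 2 * v.2 2) * h1 + h2 -
      (v.1 0 * v.2 0 + v.1 1 * v.2 1 + v.1 2 * v.2 2) * h3
  · simp [cross]; ring
  · simp [cross]; ring

lemma dir_frame (v : V3 × V3) (hv : v ∈ StP) (s : ℝ) : (v.1, dir v.1 v.2 s) ∈ StP := by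
  obtain ⟨h4, h5, h6⟩ := frame_z v hv
  obtain ⟨h1, h2, h3⟩ := hv
  refine ⟨h1, ?_, ?_⟩
  · simp only [Fin.sum_univ_three, dir, Pi.add_apply, Pi.smul_apply, smul_eq_mul] at *
    linear_combination Real.cos s ^ 2 * h2 + Real.sin s ^ 2 * h4 +
      2 * Real.cos s * Real.sin s * h6 + Real.sin_sq_add_cos_sq s
  · simp only [Fin.sum_univ_three, dir, Pi.add_apply, Pi.smul_apply, smul_eq_mul] at *
    linear_combination Real.cos s * h3 + Real.sin s * h5

lemma flip_frame (v : V3 × V3) (hv : v ∈ StP) : (-v.1, v.2) ∈ StP := by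
  obtain ⟨h1, h2, h3⟩ := hv
  refine ⟨by simpa using h1, h2, by simpa using h3⟩

lemma decomp (v : V3 × V3) (hv : v ∈ StP) (p : V3) :
    p = (∑ i, p i * v.1 i) • v.1 + ((wc v p).re • v.2 + (wc v p).im • cross v.1 v.2) := by
  obtain ⟨h4, h5, h6⟩ := frame_z v hv
  obtain ⟨h1, h2, h3⟩ := hv
  set z := cross v.1 v.2 with hz
  simp only [Fin.sum_univ_three] at h1 h2 h3 h4 h5 h6
  have hM : (Matrix.of ![v.1, v.2, z]) * (Matrix.of ![v.1, v.2, z]).transpose = 1 := by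
    ext i j
    rw [Matrix.mul_apply]
    fin_cases i <;> fin_cases j <;> simp [Fin.sum_univ_three] <;> linarith
  rw [mul_eq_one_comm] at hM
  have e : ∀ i j : Fin 3, v.1 i * v.1 j + v.2 i * v.2 j + z i * z j = if i = j then 1 else 0 := by
    intro i j
    have := congrFun (congrFun hM i) j
    rw [Matrix.mul_apply] at this
    simpa [Fin.sum_univ_three, Matrix.one_apply] using this
  funext j
  have h0 := e 0 j
  have h1 := e 1 j
  have h2 := e 2 j
  simp only [wc, ← hz, Fin.sum_univ_three, Pi.add_apply, Pi.smul_apply, smul_eq_mul]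
  fin_cases j <;> simp at h0 h1 h2 ⊢ <;> linear_combination -(p 0) * h0 - p 1 * h1 - p 2 * h2

lemma wc_comb (v : V3 × V3) (hv : v ∈ StP) (a b c : ℝ) :
    wc v (a • v.1 + (b • v.2 + c • cross v.1 v.2)) = ⟨b, c⟩ := by
  obtain ⟨h4, h5, h6⟩ := frame_z v hv
  obtain ⟨h1, h2, h3⟩ := hv
  simp only [wc, Fin.sum_univ_three, Pi.add_apply, Pi.smul_apply, smul_eq_mul] at *
  apply Complex.ext <;> simp only
  · linear_combination a * h3 + b * h2 + c * h6
  · linear_combination a * h5 + b * h6 + c * h4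

lemma norm_comb (v : V3 × V3) (hv : v ∈ StP) (p : V3) :
    ∑ i, p i * p i = (∑ i, p i * v.1 i) ^ 2 + ‖wc v p‖ ^ 2 := by
  have h := decomp v hv p
  rw [Complex.sq_norm, Complex.normSq_apply]
  have h0 := congrFun h 0
  have h1 := congrFun h 1
  have h2 := congrFun h 2
  simp only [wc, Fin.sum_univ_three, Pi.add_apply, Pi.smul_apply, smul_eq_mul] at *
  linear_combination p 0 * h0 + p 1 * h1 + p 2 * h2

lemma mem_sector (v : V3 × V3) (hv : v ∈ StP) (p : Sph) (α β r c : ℝ) (hr : 0 < r)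
    (hc : c ∈ Set.Ioo α β) (hw : wc v p.1 = r * ec c) : p.1 ∈ sector v.1 v.2 α β := by
  have hn := norm_comb v hv p.1
  have hd := decomp v hv p.1
  have hp := p.2
  rw [hp] at hn
  set q := ∑ i, p.1 i * v.1 i
  have hnw : ‖wc v p.1‖ = r := by
    have : ‖ec c‖ = 1 := by
      have h1 : ‖ec c‖ ^ 2 = 1 := by
        rw [Complex.sq_norm, Complex.normSq_apply]; simp only [ec]
        nlinarith [Real.sin_sq_add_cos_sq c]
      nlinarith [norm_nonneg (ec c)]
    rw [hw, norm_mul, this, Complex.norm_real, Real.norm_of_nonneg hr.le, mul_one]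
  rw [hnw] at hn
  have hq1 : -1 < q := by nlinarith
  have hq2 : q < 1 := by nlinarith
  refine ⟨Real.arccos q, ⟨Real.arccos_pos.2 hq2, ?_⟩, c, hc, ?_⟩
  · refine lt_of_le_of_ne (Real.arccos_le_pi _) fun h => ?_
    have := Real.cos_arccos hq1.le hq2.le
    rw [h, Real.cos_pi] at this
    linarith
  · rw [Real.cos_arccos hq1.le hq2.le, Real.sin_arccos, show 1 - q ^ 2 = r ^ 2 by linarith,
      Real.sqrt_sq hr.le]
    rw [hw] at hd
    simp only [ec, Complex.mul_re, Complex.mul_im, Complex.ofReal_re, Complex.ofReal_im] at hd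
    conv_lhs => rw [hd]
    funext i
    simp [dir]; ring

lemma sector_wc (v : V3 × V3) (hv : v ∈ StP) (p : V3) (α β : ℝ)
    (hp : p ∈ sector v.1 v.2 α β) :
    ∃ r : ℝ, 0 < r ∧ ∃ c ∈ Set.Ioo α β, wc v p = (r : ℂ) * ec c := by
  obtain ⟨s, hs, t, ht, rfl⟩ := hp
  refine ⟨Real.sin s, Real.sin_pos_of_mem_Ioo hs, t, ht, ?_⟩
  have := wc_comb v hv (Real.cos s) (Real.sin s * Real.cos t) (Real.sin s * Real.sin t)
  rw [dir, smul_add, smul_smul, smul_smul, this]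
  apply Complex.ext <;> simp [ec, -Complex.ofReal_sin, -Complex.ofReal_cos]

/-- Outside a null set, the rotated coordinate is not real. -/
lemma ae_im (μ : Measure Sph) (hμ : Proper μ) (v : V3 × V3) (hv : v ∈ StP) (t : ℝ) :
    ∀ᵐ p : Sph ∂μ, (rotc t * wc v p.1).im ≠ 0 := by
  have hv' := dir_frame v hv t
  obtain ⟨h4, -, -⟩ := frame_z _ hv'
  have := hμ.1 (cross v.1 (dir v.1 v.2 t)) (by
    intro h
    simp [h] at h4) 0
  rw [ae_iff]
  convert this using 4 with p
  rw [← wc_rot v hv]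
  simp [wc]

lemma ph_bound (v : V3 × V3) (t : ℝ) (p : V3) : ‖ph v t p‖ ≤ π := Complex.abs_arg_le_pi _

lemma ph_measurable (v : V3 × V3) (t : ℝ) : Measurable (fun p : Sph => ph v t p.1) := by
  have : Continuous (fun p : Sph => -(rotc t * wc v p.1)) := by
    have := wc_continuous.comp (f := fun p : Sph => (v, p.1)) (by fun_prop)
    simp only [Function.comp_def] at this
    fun_prop
  exact Complex.measurable_arg.comp this.measurable

lemma ph_integrable (μ : Measure Sph) [IsProbabilityMeasure μ] (v : V3 × V3) (t : ℝ) :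
    Integrable (fun p : Sph => ph v t p.1) μ :=
  Integrable.of_bound (ph_measurable v t).aestronglyMeasurable π
    (Filter.Eventually.of_forall fun p => ph_bound v t p.1)

lemma PP_continuous (μ : Measure Sph) [IsProbabilityMeasure μ] (hμ : Proper μ) :
    Continuous (fun q : {v : V3 × V3 // v ∈ StP} × ℝ => PP μ q.1.1 q.2) := by
  refine continuous_snd.add ?_
  rw [continuous_iff_continuousAt]
  intro q
  refine continuousAt_of_dominated (bound := fun _ => π) ?_ ?_ (integrable_const _) ?_
  · exact Filter.Eventually.of_forall fun q => (ph_measurable _ _).aestronglyMeasurable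
  · exact Filter.Eventually.of_forall fun q => Filter.Eventually.of_forall fun p => ph_bound _ _ _
  · filter_upwards [ae_im μ hμ q.1.1 q.1.2 q.2] with p hp
    have hc : Continuous (fun q : {v : V3 × V3 // v ∈ StP} × ℝ => -(rotc q.2 * wc q.1.1 p.1)) := by
      have h1 := wc_continuous.comp (f := fun q : {v : V3 × V3 // v ∈ StP} × ℝ => (q.1.1, p.1))
        (by fun_prop)
      have h2 := rotc_continuous
      simp only [Function.comp_def] at h1
      fun_prop
    have := Complex.continuousAt_arg (x := -(rotc q.2 * wc q.1.1 p.1))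
      (Or.inr (by rw [Complex.neg_im]; exact neg_ne_zero.2 hp))
    exact ContinuousAt.comp (f := fun q : {v : V3 × V3 // v ∈ StP} × ℝ =>
      -(rotc q.2 * wc q.1.1 p.1)) this hc.continuousAt

lemma PP_rot (μ : Measure Sph) (v : V3 × V3) (hv : v ∈ StP) (s t : ℝ) :
    PP μ (v.1, dir v.1 v.2 s) t = PP μ v (t + s) - s := by
  simp only [PP, ph, wc_rot v hv, rotc_add, mul_assoc]
  ring

lemma PP_flip (μ : Measure Sph) (hμ : Proper μ) (v : V3 × V3)
    (hv : v ∈ StP) (t : ℝ) :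
    PP μ (-v.1, v.2) t = - PP μ v (-t) := by
  simp only [PP]
  rw [neg_add, neg_neg, ← integral_neg]
  congr 1
  apply integral_congr_ae
  filter_upwards [ae_im μ hμ v hv (-t)] with p hp
  simp only [ph, wc_flip]
  have : -(rotc t * (starRingEnd ℂ) (wc v p.1)) = (starRingEnd ℂ) (-(rotc (-t) * wc v p.1)) := by
    apply Complex.ext <;> simp [rotc]
  rw [this, Complex.arg_conj, if_neg]
  intro h
  rw [Complex.arg_eq_pi_iff] at h
  exact hp (by have := h.2; rwa [Complex.neg_im, neg_eq_zero] at this)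

lemma PP_period (μ : Measure Sph) (v : V3 × V3) (t : ℝ) :
    PP μ v (t + 2 * π) = PP μ v t + 2 * π := by
  have : rotc (t + 2 * π) = rotc t := by simp [rotc]
  simp only [PP, ph, this]
  ring

lemma PP_near (μ : Measure Sph) [IsProbabilityMeasure μ] (v : V3 × V3) (t : ℝ) :
    |PP μ v t - t| ≤ π := by
  have := norm_integral_le_of_norm_le_const (μ := μ) (f := fun p : Sph => ph v t p.1)
    (Filter.Eventually.of_forall fun p => ph_bound v t p.1)
  simpa [PP] using this

lemma PP_sector (μ : Measure Sph) [IsProbabilityMeasure μ] (hμ : Proper μ) (v : V3 × V3)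
    (hv : v ∈ StP) (α β : ℝ) (h1 : α ≤ β) (h2 : β ≤ α + 2 * π) :
    PP μ v β - PP μ v α = 2 * π * (μ (Subtype.val ⁻¹' sector v.1 v.2 α β)).toReal := by
  have hpi := Real.pi_pos
  have key : ∀ᵐ p : Sph ∂μ,
      (p.1 ∈ sector v.1 v.2 α β ∧ (β - α) + (ph v β p.1 - ph v α p.1) = 2 * π) ∨
      (p.1 ∉ sector v.1 v.2 α β ∧ (β - α) + (ph v β p.1 - ph v α p.1) = 0) := by
    filter_upwards [ae_im μ hμ v hv α, ae_im μ hμ v hv β] with p hp hq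
    set w := wc v p.1 with hw
    set u := -(rotc α * w) with hu
    have hw0 : w ≠ 0 := by
      intro h; simp [h] at hp
    have hu0 : u ≠ 0 := by
      intro h
      apply hp
      have := congrArg Complex.im h
      rwa [hu, Complex.neg_im, Complex.zero_im, neg_eq_zero] at this
    have hr : 0 < ‖u‖ := norm_pos_iff.2 hu0
    have hupi : u.arg ≠ π := by
      intro h
      rw [Complex.arg_eq_pi_iff] at h
      exact hp (by have := h.2; rwa [hu, Complex.neg_im, neg_eq_zero] at this)
    have hua := Complex.neg_pi_lt_arg u
    have hub := lt_of_le_of_ne (Complex.arg_le_pi u) hupi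
    set r := ‖u‖ with hrdef
    obtain ⟨c, hcdef⟩ : ∃ c, c = u.arg + α + π := ⟨_, rfl⟩
    have hwp : w = r * ec c := by
      have e1 : rotc (-α) * rotc α = 1 := by
        rw [← rotc_add]; apply Complex.ext <;> simp [rotc]
      have e2 : w = - (rotc (-α) * u) := by
        rw [hu]; linear_combination -w * e1
      rw [e2, polar u, mul_left_comm, rotc_ec, hcdef,
        show u.arg + α + π = (u.arg - -α) + π by ring, ec_add_pi]
      ring
    have hα : ph v α p.1 = c - α - π := by
      change u.arg = _
      rw [hcdef]; ring
    have hβ : ph v β p.1 = Complex.arg (r * -ec (c - β)) := by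
      unfold ph
      rw [← hw, hwp, mul_left_comm, rotc_ec, mul_neg]
    have hcβ : c ≠ β := by
      rintro h
      apply hq
      rw [hwp, mul_left_comm, rotc_ec, h]
      simp [ec]
    rcases lt_or_gt_of_ne hcβ with hlt | hgt
    · left
      refine ⟨mem_sector v hv p α β r c hr ⟨by linarith, hlt⟩ hwp, ?_⟩
      rw [hα, hβ, ← ec_add_pi, arg_ec _ _ hr ⟨by linarith, by linarith⟩]
      ring
    · right
      constructor
      · intro hs
        obtain ⟨r', hr', d, hd, hwd⟩ := sector_wc v hv p.1 α β hs
        rw [← hw] at hwd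
        have a1 : Complex.arg (-(rotc α * w)) = d - α - π := by
          rw [hwd, mul_left_comm, rotc_ec, ← mul_neg, ← ec_sub_pi]
          exact arg_ec _ _ hr' ⟨by linarith [hd.1], by linarith [hd.2]⟩
        have a2 : u.arg = d - α - π := a1
        linarith [hd.2]
      · rw [hα, hβ, ← ec_sub_pi, arg_ec _ _ hr ⟨by linarith, by linarith⟩]
        ring
  set g : Sph → ℝ := fun p => (β - α) + (ph v β p.1 - ph v α p.1) with hg
  have hgm : Measurable g := ((ph_measurable v β).sub (ph_measurable v α)).const_add _
  set S : Set Sph := {p | π < g p} with hS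
  have hSm : MeasurableSet S := measurableSet_lt measurable_const hgm
  have hSs : (Subtype.val ⁻¹' sector v.1 v.2 α β : Set Sph) =ᵐ[μ] S := by
    filter_upwards [key] with p hp
    apply propext
    change p.1 ∈ sector v.1 v.2 α β ↔ π < g p
    rcases hp with ⟨a, b⟩ | ⟨a, b⟩
    · have : g p = 2 * π := b
      simp only [a, true_iff]; linarith
    · have : g p = 0 := b
      simp only [a, false_iff]; linarith
  have hgi : ∫ p, g p ∂μ = ∫ p, S.indicator (fun _ => 2 * π) p ∂μ := by
    apply integral_congr_ae
    filter_upwards [key] with p hp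
    rcases hp with ⟨a, b⟩ | ⟨a, b⟩
    · have e : g p = 2 * π := b
      rw [Set.indicator_of_mem (by change π < g p; linarith), e]
    · have e : g p = 0 := b
      rw [Set.indicator_of_notMem (by change ¬ (π < g p); linarith), e]
  rw [measure_congr hSs]
  rw [integral_indicator_const _ hSm] at hgi
  have hgi2 : ∫ p, g p ∂μ = PP μ v β - PP μ v α := by
    have : ∫ p, g p ∂μ = ∫ p, ((β - α) + (fun p : Sph => ph v β p.1 - ph v α p.1) p) ∂μ := rfl
    have hi : Integrable (fun p : Sph => ph v β p.1 - ph v α p.1) μ :=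
      (ph_integrable μ v β).sub (ph_integrable μ v α)
    rw [this, integral_add (integrable_const _) hi,
      integral_sub (ph_integrable μ v β) (ph_integrable μ v α)]
    simp [PP]; ring
  rw [← hgi2, hgi, smul_eq_mul, Measure.real, mul_comm]

lemma sector_pos (μ : Measure Sph) (hμ : Proper μ) (v : V3 × V3)
    (hv : v ∈ StP) (α β : ℝ) (h1 : α < β) :
    0 < μ (Subtype.val ⁻¹' sector v.1 v.2 α β) := by
  set c := (α + β) / 2 with hc
  set f : Sph → ℂ := fun p => rotc c * wc v p.1 with hf
  have hfc : Continuous f := by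
    have := wc_continuous.comp (f := fun p : Sph => (v, p.1)) (by fun_prop)
    simp only [Function.comp_def] at this
    fun_prop
  have hO : IsOpen (Complex.slitPlane ∩ Complex.arg ⁻¹' Set.Ioo (-((β - α) / 2)) ((β - α) / 2)) := by
    apply ContinuousOn.isOpen_inter_preimage _ Complex.isOpen_slitPlane isOpen_Ioo
    intro z hz
    exact (Complex.continuousAt_arg hz).continuousWithinAt
  have hpos := hμ.2 _ (hO.preimage hfc) ?_
  · refine lt_of_lt_of_le hpos (measure_mono ?_)
    rintro p ⟨hp1, hp2⟩
    have hu0 : f p ≠ 0 := Complex.slitPlane_ne_zero hp1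
    refine mem_sector v hv p α β ‖f p‖ ((f p).arg + c) (norm_pos_iff.2 hu0) ?_ ?_
    · obtain ⟨h3, h4⟩ := hp2
      constructor <;> linarith
    · have e1 : rotc (-c) * rotc c = 1 := by
        rw [← rotc_add]; apply Complex.ext <;> simp [rotc]
      have e2 : wc v p.1 = rotc (-c) * f p := by
        rw [hf]; linear_combination -(wc v p.1) * e1
      rw [e2]
      conv_lhs => rw [polar (f p)]
      rw [mul_left_comm, rotc_ec, sub_neg_eq_add]
  · have hd := (dir_frame v hv c).2.1
    refine ⟨⟨dir v.1 v.2 c, hd⟩, ?_⟩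
    have hwd : f ⟨dir v.1 v.2 c, hd⟩ = 1 := by
      have := wc_comb v hv 0 (Real.cos c) (Real.sin c)
      rw [zero_smul, zero_add] at this
      simp only [hf]
      rw [dir, this]
      change rotc c * ec c = 1
      rw [rotc_ec, sub_self]
      apply Complex.ext <;> simp [ec]
    rw [Set.mem_preimage, hwd]
    refine ⟨Complex.one_mem_slitPlane, ?_⟩
    simp only [Set.mem_preimage, Complex.arg_one]
    constructor <;> linarith

lemma PP_strictMono (μ : Measure Sph) [IsProbabilityMeasure μ] (hμ : Proper μ) (v : V3 × V3)
    (hv : v ∈ StP) : StrictMono (PP μ v) := by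
  have hpi := Real.pi_pos
  have small : ∀ α β, α < β → β ≤ α + 2 * π → PP μ v α < PP μ v β := by
    intro α β h h'
    have e := PP_sector μ hμ v hv α β h.le h'
    have := ENNReal.toReal_pos (sector_pos μ hμ v hv α β h).ne' (measure_ne_top _ _)
    have : 0 < 2 * π * (μ (Subtype.val ⁻¹' sector v.1 v.2 α β)).toReal := by positivity
    linarith
  intro α β h
  by_cases h' : β ≤ α + 2 * π
  · exact small α β h h'
  · have hper : Function.Periodic (fun t => PP μ v t - t) (2 * π) := by
      intro t
      simp only [PP_period]; ring
    have e := hper.sub_int_mul_eq ⌊(β - α) / (2 * π)⌋ (x := β)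
    set N : ℤ := ⌊(β - α) / (2 * π)⌋ with hN
    have hN1 : (1 : ℝ) ≤ N := by
      have : 1 ≤ N := by
        rw [hN, Int.le_floor, le_div_iff₀ (by positivity)]
        push_cast; linarith
      exact_mod_cast this
    have l1 : N * (2 * π) ≤ β - α := by
      rw [← le_div_iff₀ (by positivity)]; exact Int.floor_le _
    have l2 : β - α < (N + 1) * (2 * π) := by
      rw [← div_lt_iff₀ (by positivity)]; exact Int.lt_floor_add_one _
    have l3 : PP μ v α ≤ PP μ v (β - N * (2 * π)) := by
      rcases eq_or_lt_of_le (show α ≤ β - N * (2 * π) by linarith) with h | h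
      · rw [← h]
      · exact (small _ _ h (by linarith)).le
    nlinarith

lemma PP_exists (μ : Measure Sph) [IsProbabilityMeasure μ] (hμ : Proper μ)
    (v : {v : V3 × V3 // v ∈ StP}) (u : ℝ) : ∃ t, PP μ v.1 t = u := by
  have hc : Continuous (PP μ v.1) :=
    (PP_continuous μ hμ).comp (f := fun t : ℝ => (v, t)) (by fun_prop)
  have h1 := abs_le.1 (PP_near μ v.1 (u - π))
  have h2 := abs_le.1 (PP_near μ v.1 (u + π))
  exact mem_range_of_exists_le_of_exists_ge hc ⟨u - π, by linarith [h1.2]⟩ ⟨u + π, by linarith [h2.1]⟩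

/-- The inverse of the angular distribution function. -/
def BB (μ : Measure Sph) [IsProbabilityMeasure μ] (hμ : Proper μ)
    (v : {v : V3 × V3 // v ∈ StP}) (u : ℝ) : ℝ := (PP_exists μ hμ v u).choose

lemma PP_BB (μ : Measure Sph) [IsProbabilityMeasure μ] (hμ : Proper μ)
    (v : {v : V3 × V3 // v ∈ StP}) (u : ℝ) : PP μ v.1 (BB μ hμ v u) = u :=
  (PP_exists μ hμ v u).choose_spec

lemma BB_eq (μ : Measure Sph) [IsProbabilityMeasure μ] (hμ : Proper μ)
    (v : {v : V3 × V3 // v ∈ StP}) (u t : ℝ) (h : PP μ v.1 t = u) : BB μ hμ v u = t :=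
  (PP_strictMono μ hμ v.1 v.2).injective ((PP_BB μ hμ v u).trans h.symm)

lemma BB_strictMono (μ : Measure Sph) [IsProbabilityMeasure μ] (hμ : Proper μ)
    (v : {v : V3 × V3 // v ∈ StP}) : StrictMono (BB μ hμ v) := by
  intro a b h
  rw [← (PP_strictMono μ hμ v.1 v.2).lt_iff_lt, PP_BB, PP_BB]
  exact h

lemma BB_continuous (μ : Measure Sph) [IsProbabilityMeasure μ] (hμ : Proper μ) (u : ℝ) :
    Continuous (fun v => BB μ hμ v u) := by
  have hP : ∀ t, Continuous (fun v : {v : V3 × V3 // v ∈ StP} => PP μ v.1 t) := fun t =>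
    (PP_continuous μ hμ).comp (f := fun v => (v, t)) (by fun_prop)
  rw [continuous_iff_continuousAt]
  intro v0
  rw [ContinuousAt, Metric.tendsto_nhds]
  intro ε hε
  have hm := PP_strictMono μ hμ v0.1 v0.2
  have hB := PP_BB μ hμ v0 u
  have h1 : PP μ v0.1 (BB μ hμ v0 u - ε) < u := by
    conv_rhs => rw [← hB]
    exact hm (by linarith)
  have h2 : u < PP μ v0.1 (BB μ hμ v0 u + ε) := by
    conv_lhs => rw [← hB]
    exact hm (by linarith)
  filter_upwards [(hP _).continuousAt.eventually_lt_const h1,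
    (hP _).continuousAt.eventually_const_lt h2] with v hv1 hv2
  have hm' := PP_strictMono μ hμ v.1 v.2
  rw [← PP_BB μ hμ v u, hm'.lt_iff_lt] at hv1
  rw [← PP_BB μ hμ v u] at hv2
  rw [PP_BB μ hμ v u] at hv2
  have hv3 : PP μ v.1 (BB μ hμ v u) < PP μ v.1 (BB μ hμ v0 u + ε) := by
    rw [PP_BB]; exact hv2
  rw [hm'.lt_iff_lt] at hv3
  rw [PP_BB μ hμ v u] at hv1
  rw [Real.dist_eq, abs_lt]
  constructor <;> linarith

lemma BB_period (μ : Measure Sph) [IsProbabilityMeasure μ] (hμ : Proper μ)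
    (v : {v : V3 × V3 // v ∈ StP}) (u : ℝ) :
    BB μ hμ v (u + 2 * π) = BB μ hμ v u + 2 * π := by
  apply BB_eq
  rw [PP_period, PP_BB]

/-- Values on cyclically indexed sectors. -/
def ff (n : ℕ) (μ₀ : Measure Sph) [IsProbabilityMeasure μ₀] (h₀ : Proper μ₀) (μ : Measure Sph)
    (v : {v : V3 × V3 // v ∈ StP}) (i : ℤ) : ℝ :=
  PP μ v.1 (BB μ₀ h₀ v (2 * π * ((i : ℝ) + 1) / n)) - PP μ v.1 (BB μ₀ h₀ v (2 * π * (i : ℝ) / n))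
    - 2 * π / n

section aux
variable (n : ℕ) [NeZero n] (μ₀ : Measure Sph) [IsProbabilityMeasure μ₀] (h₀ : Proper μ₀)
  (μ : Measure Sph)

lemma ff_period (v : {v : V3 × V3 // v ∈ StP}) : Function.Periodic (ff n μ₀ h₀ μ v) (n : ℤ) := by
  intro i
  have hn : (n : ℝ) ≠ 0 := NeZero.ne _
  simp only [ff]
  push_cast
  rw [show 2 * π * ((i : ℝ) + n + 1) / n = 2 * π * ((i : ℝ) + 1) / n + 2 * π by field_simp; ring,
    show 2 * π * ((i : ℝ) + n) / n = 2 * π * (i : ℝ) / n + 2 * π by field_simp,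
    BB_period, BB_period, PP_period, PP_period]
  ring

lemma ff_congr (v : {v : V3 × V3 // v ∈ StP}) (i j : ℤ) (h : (i : ZMod n) = (j : ZMod n)) :
    ff n μ₀ h₀ μ v i = ff n μ₀ h₀ μ v j := by
  rw [ZMod.intCast_eq_intCast_iff] at h
  obtain ⟨c, hc⟩ := h.dvd
  have := (ff_period n μ₀ h₀ μ v).int_mul c i
  rw [← this]
  congr 1
  linear_combination -hc

lemma ff_rot (v w : {v : V3 × V3 // v ∈ StP}) (k : ℕ)
    (hw : w.1 = (v.1.1, dir v.1.1 v.1.2 (2 * π * (k : ℝ) / n))) (i : ℤ) :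
    ff n μ₀ h₀ μ w i = ff n μ₀ h₀ μ v (i + k) := by
  have hB : ∀ u, BB μ₀ h₀ w u =
      BB μ₀ h₀ v (u + 2 * π * (k : ℝ) / n) - 2 * π * (k : ℝ) / n := by
    intro u
    apply BB_eq
    rw [hw, PP_rot _ _ v.2, sub_add_cancel, PP_BB]
    ring
  simp only [ff, hB]
  rw [hw, PP_rot _ _ v.2, PP_rot _ _ v.2, sub_add_cancel, sub_add_cancel]
  push_cast
  rw [show 2 * π * ((i : ℝ) + 1) / n + 2 * π * (k : ℝ) / n = 2 * π * ((i : ℝ) + k + 1) / n by ring,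
    show 2 * π * (i : ℝ) / n + 2 * π * (k : ℝ) / n = 2 * π * ((i : ℝ) + k) / n by ring]
  ring

lemma ff_flip (hμ : Proper μ) (v w : {v : V3 × V3 // v ∈ StP})
    (hw : w.1 = (-v.1.1, v.1.2)) (i : ℤ) :
    ff n μ₀ h₀ μ w i = ff n μ₀ h₀ μ v (-1 - i) := by
  have hB : ∀ u, BB μ₀ h₀ w u = - BB μ₀ h₀ v (-u) := by
    intro u
    apply BB_eq
    rw [hw, PP_flip _ h₀ _ v.2, neg_neg, PP_BB, neg_neg]
  simp only [ff, hB]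
  rw [hw, PP_flip _ hμ _ v.2, PP_flip _ hμ _ v.2, neg_neg, neg_neg]
  push_cast
  rw [show -(2 * π * ((i : ℝ) + 1) / n) = 2 * π * (-1 - (i : ℝ)) / n by ring,
    show -(2 * π * (i : ℝ) / n) = 2 * π * (-1 - (i : ℝ) + 1) / n by ring]
  ring

/-- The map on columns. -/
def FF (v : {v : V3 × V3 // v ∈ StP}) (t : ZMod n) : ℝ := ff n μ₀ h₀ μ v (t.val : ℤ)

lemma FF_cast (v : {v : V3 × V3 // v ∈ StP}) (i : ℤ) :
    FF n μ₀ h₀ μ v (i : ZMod n) = ff n μ₀ h₀ μ v i := by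
  apply ff_congr
  simp

lemma FF_equiv (hμ : Proper μ) (g : DihedralGroup n) (v w : {v : V3 × V3 // v ∈ StP})
    (hw : w.1 = stAct n g v.1) (t : ZMod n) :
    FF n μ₀ h₀ μ w t = FF n μ₀ h₀ μ v (dperm g t) := by
  cases g with
  | r k =>
    rw [FF, ff_rot n μ₀ h₀ μ v w k.val hw, FF]
    apply ff_congr
    simp [dperm]
  | sr k =>
    have hu := dir_frame v.1 v.2 (2 * π * (k.val : ℝ) / n)
    rw [FF, ff_flip n μ₀ h₀ μ hμ ⟨_, hu⟩ w hw, ff_rot n μ₀ h₀ μ v ⟨_, hu⟩ k.val rfl, FF]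
    apply ff_congr
    simp [dperm]
    ring

lemma ff_sum (v : {v : V3 × V3 // v ∈ StP}) (c d : ℕ) :
    ∑ i ∈ Finset.Ico c (c + d), FF n μ₀ h₀ μ v (i : ZMod n) =
      PP μ v.1 (BB μ₀ h₀ v (2 * π * ((c : ℝ) + d) / n)) - PP μ v.1 (BB μ₀ h₀ v (2 * π * (c : ℝ) / n))
        - 2 * π * d / n := by
  induction d with
  | zero => simp
  | succ d ih =>
    rw [← add_assoc, Finset.sum_Ico_succ_top (by omega), ih]
    have := FF_cast n μ₀ h₀ μ v ((c + d : ℕ) : ℤ)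
    rw [Int.cast_natCast] at this
    rw [this, ff]
    push_cast
    rw [add_assoc (c : ℝ) d 1]
    ring

lemma FF_sum_zero (v : {v : V3 × V3 // v ∈ StP}) : ∑ t, FF n μ₀ h₀ μ v t = 0 := by
  have h := ff_sum n μ₀ h₀ μ v 0 n
  have hn : (n : ℝ) ≠ 0 := NeZero.ne _
  have e : ∑ t, FF n μ₀ h₀ μ v t = ∑ i ∈ Finset.Ico 0 (0 + n), FF n μ₀ h₀ μ v (i : ZMod n) := by
    symm
    refine Finset.sum_nbij' (fun i => (i : ZMod n)) (fun t => t.val) ?_ ?_ ?_ ?_ ?_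
    · simp
    · intro t _
      simpa using ZMod.val_lt t
    · intro i hi
      exact ZMod.val_cast_of_lt (by simpa using hi)
    · simp
    · simp
  rw [e, h]
  have e1 : 2 * π * (((0 : ℕ) : ℝ) + n) / n = 0 + 2 * π := by field_simp; simp; ring
  have e2 : 2 * π * ((0 : ℕ) : ℝ) / n = 0 := by simp
  rw [e1, e2, BB_period, PP_period]
  field_simp
  ring

lemma FF_continuous [IsProbabilityMeasure μ] (hμ : Proper μ) (t : ZMod n) :
    Continuous (fun v => FF n μ₀ h₀ μ v t) := by
  have h : ∀ u, Continuous (fun v => PP μ v.1 (BB μ₀ h₀ v u)) := fun u =>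
    (PP_continuous μ hμ).comp (f := fun v => (v, BB μ₀ h₀ v u))
      (continuous_id.prodMk (BB_continuous μ₀ h₀ u))
  exact ((h _).sub (h _)).sub continuous_const

end aux

lemma stAct_frame (n : ℕ) (g : DihedralGroup n) (v : V3 × V3) (hv : v ∈ StP) :
    stAct n g v ∈ StP := by
  cases g with
  | r k => exact dir_frame v hv _
  | sr k => exact flip_frame _ (dir_frame v hv _)

lemma psum_succ {k : ℕ} (a : Fin k → ℕ) (i : Fin k) (h : (i : ℕ) + 1 < k) :
    psum a ⟨(i : ℕ) + 1, h⟩ = psum a i + a i := by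
  unfold psum
  have : Finset.univ.filter (fun j : Fin k => j < ⟨(i : ℕ) + 1, h⟩) =
      insert i (Finset.univ.filter (fun j : Fin k => j < i)) := by
    ext j
    simp only [Finset.mem_filter, Finset.mem_univ, true_and, Finset.mem_insert, Fin.lt_def,
      Fin.ext_iff]
    omega
  rw [this, Finset.sum_insert (by simp), add_comm]

lemma psum_last {k : ℕ} (a : Fin k → ℕ) (i : Fin k) (h : ¬ (i : ℕ) + 1 < k) :
    psum a i + a i = ∑ j, a j := by
  unfold psum
  have : (Finset.univ : Finset (Fin k)) =
      insert i (Finset.univ.filter (fun j : Fin k => j < i)) := by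
    ext j
    simp only [Finset.mem_filter, Finset.mem_univ, true_and, Finset.mem_insert, Fin.lt_def,
      Fin.ext_iff]
    have := j.isLt
    constructor
    · intro _; omega
    · intro _; trivial
  conv_rhs => rw [this]
  rw [Finset.sum_insert (by simp), add_comm]

lemma psum_add_le {k : ℕ} (a : Fin k → ℕ) (i : Fin k) :
    psum a i + a i ≤ ∑ j, a j := by
  unfold psum
  rw [add_comm, ← Finset.sum_insert (by simp)]
  exact Finset.sum_le_sum_of_subset (Finset.subset_univ _)

lemma psum_lt {k : ℕ} (a : Fin k → ℕ) (hpos : ∀ i, 0 < a i) (i j : Fin k) (h : i < j) :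
    psum a i < psum a j := by
  have : psum a i + a i ≤ psum a j := by
    unfold psum
    rw [add_comm, ← Finset.sum_insert (by simp)]
    apply Finset.sum_le_sum_of_subset
    intro l hl
    simp only [Finset.mem_filter, Finset.mem_univ, true_and, Finset.mem_insert] at hl ⊢
    rcases hl with rfl | hl
    · exact h
    · exact hl.trans h
  have := hpos i
  omega

theorem fan_partition_from_no_equivariant_map
    (m k n : ℕ) (hm : 2 ≤ m) (hk : 2 ≤ k) (a : Fin k → ℕ)
    (hpos : ∀ i, 0 < a i) (hn : n = ∑ i, a i) [NeZero n]
    (hF : ¬ ∃ F : {v : V3 × V3 // v ∈ StP} → Mat n m,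
        Continuous F ∧
        (∀ (g : DihedralGroup n) (v w : {v : V3 × V3 // v ∈ StP}),
          (w : V3 × V3) = stAct n g (v : V3 × V3) → F w = dAct g (F v)) ∧
        (∀ v, F v ∈ Mset n m a))
    (μ : Fin m → Measure Sph)
    (hprob : ∀ j, IsProbabilityMeasure (μ j)) (hproper : ∀ j, Proper (μ j)) :
    ∃ x y : V3, ∃ θ : Fin k → ℝ, IsFrame x y ∧ StrictMono θ ∧
      (∀ i j : Fin k, θ j < θ i + 2 * Real.pi) ∧
      ∀ (j : Fin m) (i : Fin k),
        (μ j) (Subtype.val ⁻¹' sector x y (θ i) (θnext θ i)) =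
          ENNReal.ofReal ((a i : ℝ) / n) := by
  by_contra hcon
  apply hF
  have := hprob
  have hm0 : 0 < m := by omega
  set μ₀ := μ ⟨0, hm0⟩ with hμ₀
  have h₀ : Proper μ₀ := hproper _
  let e : Fin (m - 1) → Fin m := fun j => ⟨j.1 + 1, by omega⟩
  have hnR : (0 : ℝ) < n := by exact_mod_cast Nat.pos_of_ne_zero (NeZero.ne n)
  have hpi := Real.pi_pos
  let F : {v : V3 × V3 // v ∈ StP} → Mat n m := fun v t j => FF n μ₀ h₀ (μ (e j)) v t
  have hFe : ∀ (g : DihedralGroup n) (v w : {v : V3 × V3 // v ∈ StP}),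
          (w : V3 × V3) = stAct n g (v : V3 × V3) → F w = dAct g (F v) := by
    intro g v w hw
    funext t j
    exact FF_equiv n μ₀ h₀ (μ (e j)) (hproper _) g v w hw t
  have hsum : ∀ v, ∑ i, F v i = 0 := by
    intro v
    funext j
    rw [Finset.sum_apply]
    exact FF_sum_zero n μ₀ h₀ (μ (e j)) v
  refine ⟨F, ?_, hFe, ?_⟩
  · exact continuous_pi fun t => continuous_pi fun j => FF_continuous n μ₀ h₀ (μ (e j)) (hproper _) t
  intro v
  refine ⟨hsum v, fun g hg => hcon ?_⟩
  obtain ⟨w, hw⟩ : ∃ w : {v : V3 × V3 // v ∈ StP}, w.1 = stAct n g v.1 :=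
    ⟨⟨_, stAct_frame n g v.1 v.2⟩, rfl⟩
  rw [← hFe g v w hw] at hg
  obtain ⟨-, hblock⟩ := hg
  have hB := BB_strictMono μ₀ h₀ w
  have hmul : ∀ x y : ℝ, x < y → 2 * π * x / n < 2 * π * y / n := by
    intro x y h
    gcongr
  let θ : Fin k → ℝ := fun i => BB μ₀ h₀ w (2 * π * (psum a i : ℝ) / n)
  have hθn : ∀ i, θnext θ i = BB μ₀ h₀ w (2 * π * ((psum a i : ℝ) + a i) / n) := by
    intro i
    unfold θnext
    split_ifs with h
    · simp only [θ]
      rw [psum_succ]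
      push_cast
      rfl
    · have h1 := psum_last a i h
      have h2 : psum a ⟨0, Nat.lt_of_le_of_lt (Nat.zero_le _) i.isLt⟩ = 0 := by
        unfold psum
        apply Finset.sum_eq_zero
        intro j hj
        simp [Fin.lt_def] at hj
      rw [← hn] at h1
      have h3 : (psum a i : ℝ) + a i = n := by exact_mod_cast h1
      simp only [θ]
      rw [h2, h3, ← BB_period]
      congr 1
      field_simp
      simp
  refine ⟨w.1.1, w.1.2, θ, w.2, ?_, ?_, ?_⟩
  · intro i j h
    apply hB
    apply hmul
    exact_mod_cast psum_lt a hpos i j h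
  · intro i j
    simp only [θ]
    rw [← BB_period]
    apply hB
    have h1 := psum_add_le a j
    have h2 := hpos j
    have h3 : (psum a j : ℝ) < psum a i + n := by
      have : psum a j < psum a i + n := by omega
      exact_mod_cast this
    have := hmul _ _ h3
    have e1 : 2 * π * ((psum a i : ℝ) + n) / n = 2 * π * (psum a i : ℝ) / n + 2 * π := by
      field_simp
    linarith
  · intro j i
    have hdiff : PP (μ j) w.1 (θnext θ i) - PP (μ j) w.1 (θ i) = 2 * π * a i / n := by
      rw [hθn]
      by_cases hj : j.1 = 0
      · have : j = ⟨0, hm0⟩ := Fin.ext hj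
        rw [this]
        simp only [θ]
        rw [← hμ₀, PP_BB, PP_BB]
        ring
      · have h1 := congrFun (hblock i) ⟨j.1 - 1, by omega⟩
        rw [Finset.sum_apply] at h1
        have h2 := ff_sum n μ₀ h₀ (μ (e ⟨j.1 - 1, by omega⟩)) w (psum a i) (a i)
        have h3 : e ⟨j.1 - 1, by omega⟩ = j := by
          apply Fin.ext
          simp only [e]
          omega
        simp only [F] at h1
        rw [h2, h3] at h1
        simp only [Pi.zero_apply] at h1
        simp only [θ]
        linarith
    have hai : (0 : ℝ) < a i := by exact_mod_cast hpos i
    have hle : θ i ≤ θnext θ i := by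
      rw [hθn]
      exact (hB (hmul _ _ (by linarith))).le
    have hle2 : θnext θ i ≤ θ i + 2 * π := by
      rw [hθn]
      simp only [θ]
      rw [← BB_period]
      apply hB.monotone
      have h1 : (a i : ℝ) ≤ n := by
        have := psum_add_le a i
        have : a i ≤ n := by omega
        exact_mod_cast this
      have : 2 * π * ((psum a i : ℝ) + a i) / n ≤ 2 * π * ((psum a i : ℝ) + n) / n := by
        gcongr
      have e1 : 2 * π * ((psum a i : ℝ) + n) / n = 2 * π * (psum a i : ℝ) / n + 2 * π := by
        field_simp
      linarith
    have hs := PP_sector (μ j) (hproper j) w.1 w.2 _ _ hle hle2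
    rw [hdiff] at hs
    rw [← ENNReal.ofReal_toReal (measure_ne_top (μ j) _)]
    congr 1
    have h2 : 2 * π * a i / n = 2 * π * ((a i : ℝ) / n) := by ring
    rw [h2] at hs
    exact (mul_left_cancel₀ (by positivity) hs).symm

end
end

section
/- Let G be a finite group and let γ₁, γ₂ : G × S³ → S³ be two continuous actions of G on the 3-sphere S³ (by homeomorphisms), and suppose the action γ₁ is free. Then there exists a continuous map f : S³ → S³ which is equivariant from γ₁ to γ₂, i.e. f(g ·₁ x) = g ·₂ f(x) for every g ∈ G and x ∈ S³. -/
/- STATEMENT 4: If γ₁, γ₂ are two continuous actions of a finite group G on S³ and γ₁ is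
free, then there is a continuous map f : S³ → S³ equivariant from γ₁ to γ₂. -/

/-- The 3-sphere, the unit sphere in ℝ⁴. -/
abbrev S3 : Type := {x : Fin 4 → ℝ // ∑ i, x i * x i = 1}

open Set Metric Topology Filter MeasureTheory in
/-- Every continuous map from a closed subset `A` of the unit sphere of `ℝ⁴` to that sphere
extends to the whole sphere. -/
theorem sphere_extension (A : Set (EuclideanSpace ℝ (Fin 4))) (hA : IsClosed A)
    (hAS : A ⊆ sphere 0 1)
    (f : EuclideanSpace ℝ (Fin 4) → EuclideanSpace ℝ (Fin 4)) (hf : ContinuousOn f A)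
    (hfS : ∀ x ∈ A, ‖f x‖ = 1) :
    ∃ g : EuclideanSpace ℝ (Fin 4) → EuclideanSpace ℝ (Fin 4),
      ContinuousOn g (sphere 0 1) ∧ (∀ x ∈ sphere 0 1, ‖g x‖ = 1) ∧ ∀ x ∈ A, g x = f x := by
  obtain ⟨F, hF⟩ := ContinuousMap.exists_restrict_eq hA ⟨A.domRestrict f, hf.domRestrict⟩
  have hF' : ∀ x ∈ A, F x = f x := fun x hx => by
    have := DFunLike.congr_fun hF ⟨x, hx⟩
    exact this
  obtain ⟨P, hP, hPF, -⟩ := F.continuous.exists_contDiff_approx 1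
    (ε := fun _ => 1 / 8) continuous_const (fun _ => by norm_num)
  -- a small vector missed by `P` on the sphere
  have hnull : volume (P '' sphere 0 1) = 0 :=
    addHaar_image_eq_zero_of_differentiableOn_of_addHaar_eq_zero volume
      (hP.differentiable (by norm_num)).differentiableOn (Measure.addHaar_sphere _ _ _)
  obtain ⟨c, hc, hcP⟩ : ∃ c ∈ ball (0 : EuclideanSpace ℝ (Fin 4)) (1 / 8),
      c ∉ P '' sphere 0 1 := by
    by_contra! hcon
    have h1 : volume (ball (0 : EuclideanSpace ℝ (Fin 4)) (1 / 8)) = 0 :=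
      measure_mono_null hcon hnull
    exact (measure_ball_pos volume (0 : EuclideanSpace ℝ (Fin 4)) (by norm_num)).ne' h1
  have hQ0 : ∀ x ∈ sphere (0 : EuclideanSpace ℝ (Fin 4)) 1, P x - c ≠ 0 := fun x hx h0 =>
    hcP ⟨x, hx, sub_eq_zero.1 h0⟩
  have hQc : Continuous fun x => P x - c := hP.continuous.sub continuous_const
  set g₀ : EuclideanSpace ℝ (Fin 4) → EuclideanSpace ℝ (Fin 4) :=
    fun x => (‖P x - c‖)⁻¹ • (P x - c) with hg₀
  have hg₀c : ContinuousOn g₀ (sphere 0 1) :=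
    (hQc.norm.continuousOn.inv₀ fun x hx => norm_ne_zero_iff.2 (hQ0 x hx)).smul hQc.continuousOn
  have hg₀n : ∀ x ∈ sphere (0 : EuclideanSpace ℝ (Fin 4)) 1, ‖g₀ x‖ = 1 := fun x hx => by
    simp only [hg₀, norm_smul, norm_inv, norm_norm]
    exact inv_mul_cancel₀ (norm_ne_zero_iff.2 (hQ0 x hx))
  have hclose : ∀ x ∈ A, ‖f x - g₀ x‖ ≤ 1 / 2 := fun x hx => by
    have hd : ‖(P x - c) - f x‖ ≤ 1 / 4 := by
      have h1 : ‖P x - F x‖ ≤ 1 / 8 := by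
        have := (hPF x).le
        rwa [dist_eq_norm] at this
      have h2 : ‖c‖ ≤ 1 / 8 := by simpa using (mem_ball_zero_iff.1 hc).le
      rw [← hF' x hx]
      calc ‖(P x - c) - F x‖ = ‖(P x - F x) - c‖ := by congr 1; abel
        _ ≤ _ := (norm_sub_le _ _).trans (by linarith)
    have hne : ‖P x - c‖ ≠ 0 := norm_ne_zero_iff.2 (hQ0 x (hAS hx))
    have h3 : ‖(P x - c) - g₀ x‖ ≤ 1 / 4 := by
      have : (P x - c) - g₀ x = (1 - ‖P x - c‖⁻¹) • (P x - c) := by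
        simp only [hg₀, sub_smul, one_smul]
      have e : (1 - ‖P x - c‖⁻¹) * ‖P x - c‖ = ‖P x - c‖ - 1 := by field_simp
      have : ‖(P x - c) - g₀ x‖ = |‖P x - c‖ - 1| := by
        rw [this, norm_smul, Real.norm_eq_abs, ← e, abs_mul, abs_norm]
      have h4 := (abs_norm_sub_norm_le (P x - c) (f x)).trans hd
      rw [hfS x hx] at h4
      rw [this]
      exact h4
    calc ‖f x - g₀ x‖ = ‖((P x - c) - g₀ x) - ((P x - c) - f x)‖ := by congr 1; abel
      _ ≤ _ := (norm_sub_le _ _).trans (by linarith)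
  have := Metric.instTietzeExtensionClosedBall.{0, 0} ℝ (0 : EuclideanSpace ℝ (Fin 4))
    (r := 1 / 2) (by norm_num)
  obtain ⟨u, hu, huA⟩ := ContinuousMap.exists_forall_mem_restrict_eq hA
    (t := closedBall (0 : EuclideanSpace ℝ (Fin 4)) (1 / 2))
    (f := ⟨A.domRestrict fun x => f x - g₀ x, (hf.sub (hg₀c.mono hAS)).domRestrict⟩)
    (fun x => mem_closedBall_zero_iff.2 (hclose x.1 x.2))
  have huA' : ∀ x ∈ A, u x = f x - g₀ x := fun x hx => by
    have := DFunLike.congr_fun huA ⟨x, hx⟩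
    exact this
  have hne : ∀ x ∈ sphere (0 : EuclideanSpace ℝ (Fin 4)) 1, ‖g₀ x + u x‖ ≠ 0 := fun x hx h0 => by
    have h1 := hg₀n x hx
    have h2 : ‖u x‖ ≤ 1 / 2 := by simpa using hu x
    have h3 : g₀ x = - u x := eq_neg_of_add_eq_zero_left (norm_eq_zero.1 h0)
    rw [h3, norm_neg] at h1
    linarith
  have hsum : ContinuousOn (fun x => g₀ x + u x) (sphere 0 1) := hg₀c.add u.continuous.continuousOn
  refine ⟨fun x => (‖g₀ x + u x‖)⁻¹ • (g₀ x + u x), (hsum.norm.inv₀ hne).smul hsum, ?_, ?_⟩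
  · intro x hx
    simp only [norm_smul, norm_inv, norm_norm]
    exact inv_mul_cancel₀ (hne x hx)
  · intro x hx
    have : g₀ x + u x = f x := by rw [huA' x hx]; abel
    simp [this, hfS x hx]

theorem S3_norm_iff (x : EuclideanSpace ℝ (Fin 4)) : ‖x‖ = 1 ↔ ∑ i, x i * x i = 1 := by
  rw [EuclideanSpace.norm_eq, Real.sqrt_eq_one]
  simp [sq]

/-- Extension for the concrete model `S3`. -/
theorem S3_extension (A : Set S3) (hA : IsClosed A) (f : S3 → S3) (hf : ContinuousOn f A) :
    ∃ h : S3 → S3, Continuous h ∧ ∀ x ∈ A, h x = f x := by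
  classical
  let ι : S3 → EuclideanSpace ℝ (Fin 4) := fun x => WithLp.toLp 2 x.1
  have hι : Continuous ι := (PiLp.continuous_toLp 2 _).comp continuous_subtype_val
  have hιS : ∀ x, ‖ι x‖ = 1 := fun x => (S3_norm_iff _).2 x.2
  have x₀ : S3 := ⟨Pi.single 0 1, by simp [Fin.sum_univ_four]⟩
  let ρ : EuclideanSpace ℝ (Fin 4) → S3 := fun y =>
    if hy : ‖y‖ = 1 then ⟨WithLp.ofLp y, (S3_norm_iff y).1 hy⟩ else x₀
  have hρι : ∀ x, ρ (ι x) = x := fun x => by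
    simp only [ρ, hιS, dite_true]; rfl
  have hιρ : ∀ y, ‖y‖ = 1 → ι (ρ y) = y := fun y hy => by
    simp only [ρ, hy, dite_true]; rfl
  have hρ : ContinuousOn ρ (Metric.sphere 0 1) := by
    rw [continuousOn_iff_continuous_domRestrict]
    refine continuous_induced_rng.2 ?_
    have : (Subtype.val ∘ (Metric.sphere (0 : EuclideanSpace ℝ (Fin 4)) 1).domRestrict ρ) =
        fun y => WithLp.ofLp y.1 := by
      funext y
      have hy : ‖y.1‖ = 1 := by simpa using y.2
      simp only [Function.comp, Set.domRestrict_apply, ρ, hy, dite_true]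
    rw [this]
    exact (PiLp.continuous_ofLp 2 _).comp continuous_subtype_val
  have : CompactSpace S3 := by
    have : ρ '' (Metric.sphere 0 1) = Set.univ := by
      refine Set.eq_univ_of_forall fun x => ⟨ι x, by simpa using hιS x, hρι x⟩
    exact ⟨this ▸ (isCompact_sphere _ _).image_of_continuousOn hρ⟩
  have hAS : ι '' A ⊆ Metric.sphere 0 1 := by
    rintro _ ⟨x, -, rfl⟩
    simpa using hιS x
  obtain ⟨g, hg, hgS, hgA⟩ := sphere_extension (ι '' A) (hA.isCompact.image hι).isClosed hAS
    (fun y => ι (f (ρ y)))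
    (hι.comp_continuousOn (hf.comp (hρ.mono hAS) (by
      rintro _ ⟨x, hx, rfl⟩
      rwa [hρι])))
    (fun x _ => hιS _)
  refine ⟨fun x => ρ (g (ι x)), ?_, ?_⟩
  · have h1 : Continuous fun x => g (ι x) :=
      hg.comp_continuous hι fun x => by simpa using hιS x
    exact hρ.comp_continuous h1 fun x => by
      simpa using hgS (ι x) (by simpa using hιS x)
  · intro x hx
    simp only [hgA (ι x) ⟨x, hx, rfl⟩, hρι]

theorem S3_compactSpace : CompactSpace S3 := by
  refine (isCompact_iff_compactSpace (s := {x : Fin 4 → ℝ | ∑ i, x i * x i = 1})).1 ?_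
  have hc : IsClosed {x : Fin 4 → ℝ | ∑ i, x i * x i = 1} :=
    isClosed_eq (by fun_prop) continuous_const
  refine (isCompact_closedBall (0 : Fin 4 → ℝ) 1).of_isClosed_subset hc fun x hx => ?_
  rw [mem_closedBall_zero_iff, pi_norm_le_iff_of_nonneg zero_le_one]
  intro i
  have : x i * x i ≤ 1 := by
    rw [← (show ∑ i, x i * x i = 1 from hx)]
    exact Finset.single_le_sum (f := fun i => x i * x i)
      (fun j _ => mul_self_nonneg _) (Finset.mem_univ i)
  rw [Real.norm_eq_abs]
  exact abs_le_one_iff_mul_self_le_one.2 this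

/-- Extending an equivariant map over the orbit of a small closed set. -/
theorem equivariant_step {G : Type*} [Group G] [Finite G] (γ₁ γ₂ : G → S3 → S3)
    (h1one : ∀ x, γ₁ 1 x = x) (h1mul : ∀ g h x, γ₁ (g * h) x = γ₁ g (γ₁ h x))
    (h1cont : ∀ g, Continuous (γ₁ g))
    (h2one : ∀ x, γ₂ 1 x = x) (h2mul : ∀ g h x, γ₂ (g * h) x = γ₂ g (γ₂ h x))
    (h2cont : ∀ g, Continuous (γ₂ g))
    (A B : Set S3) (hA : IsClosed A) (hB : IsClosed B)
    (hAinv : ∀ g x, x ∈ A → γ₁ g x ∈ A) (hBsm : ∀ g x, x ∈ B → γ₁ g x ∈ B → g = 1)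
    (f : S3 → S3) (hf : ContinuousOn f A) (hfe : ∀ g, ∀ x ∈ A, f (γ₁ g x) = γ₂ g (f x)) :
    ∃ A' : Set S3, ∃ f' : S3 → S3, A ⊆ A' ∧ B ⊆ A' ∧ IsClosed A' ∧
      (∀ g x, x ∈ A' → γ₁ g x ∈ A') ∧ ContinuousOn f' A' ∧
      ∀ g, ∀ x ∈ A', f' (γ₁ g x) = γ₂ g (f' x) := by
  classical
  obtain ⟨h, hh, hhA⟩ := S3_extension A hA f hf
  have hinv1 : ∀ g x, γ₁ g⁻¹ (γ₁ g x) = x := fun g x => by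
    rw [← h1mul, inv_mul_cancel, h1one]
  have hinv2 : ∀ g x, γ₂ g⁻¹ (γ₂ g x) = x := fun g x => by
    rw [← h2mul, inv_mul_cancel, h2one]
  let f' : S3 → S3 := fun x => if x ∈ A then f x else
    if hx : ∃ g, γ₁ g x ∈ B then γ₂ hx.choose⁻¹ (h (γ₁ hx.choose x)) else x
  have hf'A : ∀ x ∈ A, f' x = f x := fun x hx => by simp only [f', hx, if_true]
  have huniq : ∀ g g' x, γ₁ g x ∈ B → γ₁ g' x ∈ B → g' = g := fun g g' x hx hx' => by
    have : g' * g⁻¹ = 1 := hBsm _ _ hx (by rwa [h1mul, hinv1])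
    exact mul_inv_eq_one.1 this
  have hf'B : ∀ g x, γ₁ g x ∈ B → f' x = γ₂ g⁻¹ (h (γ₁ g x)) := fun g x hx => by
    by_cases hxA : x ∈ A
    · rw [hf'A x hxA, hhA _ (hAinv g x hxA), hfe g x hxA, hinv2]
    · have hex : ∃ g, γ₁ g x ∈ B := ⟨g, hx⟩
      have : hex.choose = g := huniq _ _ x hx hex.choose_spec
      simp only [f', hxA, if_false, hex, dite_true, this]
  have hcl : ∀ g, IsClosed {x | γ₁ g x ∈ B} := fun g => hB.preimage (h1cont g)
  refine ⟨A ∪ ⋃ g, {x | γ₁ g x ∈ B}, f', Set.subset_union_left, ?_, ?_, ?_, ?_, ?_⟩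
  · intro x hx
    refine Or.inr (Set.mem_iUnion.2 ⟨1, ?_⟩)
    simpa [h1one] using hx
  · exact hA.union (isClosed_iUnion_of_finite hcl)
  · rintro g x (hx | hx)
    · exact Or.inl (hAinv g x hx)
    · obtain ⟨k, hk⟩ := Set.mem_iUnion.1 hx
      refine Or.inr (Set.mem_iUnion.2 ⟨k * g⁻¹, ?_⟩)
      simpa [h1mul, hinv1] using hk
  · refine ContinuousOn.union_of_isClosed (hf.congr hf'A) ?_ hA (isClosed_iUnion_of_finite hcl)
    refine (locallyFinite_of_finite _).continuousOn_iUnion hcl fun {g} => ?_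
    refine ContinuousOn.congr (f := fun x => γ₂ g⁻¹ (h (γ₁ g x))) ?_ (fun x hx => hf'B g x hx)
    exact ((h2cont _).comp (hh.comp (h1cont g))).continuousOn
  · rintro g x (hx | hx)
    · rw [hf'A _ hx, hf'A _ (hAinv g x hx), hfe g x hx]
    · obtain ⟨k, hk⟩ := Set.mem_iUnion.1 hx
      have hk' : γ₁ k x ∈ B := hk
      have e : γ₁ (k * g⁻¹) (γ₁ g x) = γ₁ k x := by rw [h1mul, hinv1]
      rw [hf'B k x hk', hf'B (k * g⁻¹) (γ₁ g x) (by rwa [e]), e, mul_inv_rev, inv_inv, h2mul]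

theorem equivariant_map_between_actions_on_S3
    {G : Type*} [Group G] [Finite G] (γ₁ γ₂ : G → S3 → S3)
    (h1one : ∀ x, γ₁ 1 x = x) (h1mul : ∀ g h x, γ₁ (g * h) x = γ₁ g (γ₁ h x))
    (h1cont : ∀ g, Continuous (γ₁ g))
    (h2one : ∀ x, γ₂ 1 x = x) (h2mul : ∀ g h x, γ₂ (g * h) x = γ₂ g (γ₂ h x))
    (h2cont : ∀ g, Continuous (γ₂ g))
    (h1free : ∀ g : G, g ≠ 1 → ∀ x, γ₁ g x ≠ x) :
    ∃ f : S3 → S3, Continuous f ∧ ∀ (g : G) (x : S3), f (γ₁ g x) = γ₂ g (f x) := by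
  classical
  have := S3_compactSpace
  -- small closed neighbourhoods
  have hloc : ∀ x : S3, ∃ B ∈ nhds x, IsClosed B ∧
      ∀ g y, y ∈ B → γ₁ g y ∈ B → g = 1 := by
    intro x
    have hev : ∀ g : G, ∀ᶠ p : S3 × S3 in nhds x ×ˢ nhds x, g ≠ 1 → γ₁ g p.1 ≠ p.2 := by
      intro g
      by_cases hg : g = 1
      · simp [hg]
      · have ho : IsOpen {p : S3 × S3 | γ₁ g p.1 ≠ p.2} :=
          isOpen_ne_fun ((h1cont g).comp continuous_fst) continuous_snd
        rw [← nhds_prod_eq]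
        filter_upwards [ho.mem_nhds (show (x, x) ∈ _ from h1free g hg x)] with p hp _ using hp
    have hall := Filter.eventually_all.2 hev
    obtain ⟨U, hU, hUU⟩ := (Filter.eventually_prod_self_iff
      (r := fun a b => ∀ g : G, g ≠ 1 → γ₁ g a ≠ b)).1 hall
    obtain ⟨B, hB, hBc, hBU⟩ := exists_mem_nhds_isClosed_subset hU
    refine ⟨B, hB, hBc, fun g y hy hgy => ?_⟩
    by_contra hg
    exact hUU y (hBU hy) _ (hBU hgy) g hg rfl
  choose B hBn hBc hBs using hloc
  obtain ⟨t, ht⟩ := CompactSpace.elim_nhds_subcover B hBn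
  have key : ∀ t : Finset S3, ∃ A : Set S3, ∃ f : S3 → S3, (∀ x ∈ t, B x ⊆ A) ∧ IsClosed A ∧
      (∀ g x, x ∈ A → γ₁ g x ∈ A) ∧ ContinuousOn f A ∧
      ∀ g, ∀ x ∈ A, f (γ₁ g x) = γ₂ g (f x) := by
    intro t
    induction t using Finset.induction_on with
    | empty => exact ⟨∅, id, by simp, isClosed_empty, by simp, by simp, by simp⟩
    | insert a s _ ih =>
      obtain ⟨A, f, hsA, hA, hAinv, hf, hfe⟩ := ih
      obtain ⟨A', f', hAA', hBA', h⟩ := equivariant_step γ₁ γ₂ h1one h1mul h1cont h2one h2mul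
        h2cont A (B a) hA (hBc a) hAinv (hBs a) f hf hfe
      refine ⟨A', f', fun x hx => ?_, h⟩
      rcases Finset.mem_insert.1 hx with rfl | hx
      · exact hBA'
      · exact (hsA x hx).trans hAA'
  obtain ⟨A, f, htA, -, -, hf, hfe⟩ := key t
  have hAu : A = Set.univ := by
    refine Set.eq_univ_of_univ_subset ?_
    rw [← Set.top_eq_univ, ← ht]
    exact Set.iUnion₂_subset htA
  subst hAu
  exact ⟨f, continuousOn_univ.1 hf, fun g x => hfe g x (Set.mem_univ x)⟩
end

section
/- Let G be a finite group, let γ₁, γ₂ : G × S³ → S³ be two free continuous actions of G on the 3-sphere S³, and let Z be an arbitrary topological G-space. Then there exists a continuous map f : S³ → Z with f(g ·₁ x) = g·f(x) for all g ∈ G, x ∈ S³, if and only if there exists a continuous map f' : S³ → Z with f'(g ·₂ x) = g·f'(x) for all g ∈ G, x ∈ S³. -/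
open Set Filter Topology MeasureTheory in
theorem S3_null : (volume : Measure (Fin 4 → ℝ)) {x | ∑ i, x i * x i = 1} = 0 := by
  have h := (EuclideanSpace.volume_preserving_symm_measurableEquiv_toLp (Fin 4)).symm
  have h2 : (volume : Measure (EuclideanSpace ℝ (Fin 4))) (Metric.sphere 0 1) = 0 :=
    Measure.addHaar_sphere _ _ _
  rw [← (h).measure_preimage Metric.isClosed_sphere.measurableSet.nullMeasurableSet] at h2
  convert h2 using 2
  ext x
  simp [EuclideanSpace.norm_eq, pow_two]

open Set Filter Topology MeasureTheory in
theorem S3_extend (C : Set S3) (hC : IsClosed C) (f : S3 → S3) (hf : ContinuousOn f C) :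
    ∃ ψ : S3 → S3, Continuous ψ ∧ ∀ x ∈ C, ψ x = f x := by
  have hS : IsClosed {x : Fin 4 → ℝ | ∑ i, x i * x i = 1} :=
    isClosed_eq (by fun_prop) (by fun_prop)
  have he : IsClosedEmbedding (fun x : C => (x : S3).1) :=
    (hS.isClosedEmbedding_subtypeVal).comp hC.isClosedEmbedding_subtypeVal
  let f0 : C(C, Fin 4 → ℝ) := ⟨fun x => (f x).1, by
    have := hf.restrict
    exact continuous_subtype_val.comp this⟩
  obtain ⟨F, hF⟩ := ContinuousMap.exists_extension he f0
  have hFC : ∀ x ∈ C, F x.1 = (f x).1 := fun x hx => DFunLike.congr_fun hF ⟨x, hx⟩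
  obtain ⟨g, hg, hgF, -⟩ := F.continuous.exists_contDiff_approx 1 (ε := fun _ => (1/16 : ℝ))
    (by fun_prop) (by intro; norm_num)
  have hnull : (volume : Measure (Fin 4 → ℝ)) (g '' {x | ∑ i, x i * x i = 1}) = 0 :=
    addHaar_image_eq_zero_of_differentiableOn_of_addHaar_eq_zero _
      (hg.differentiable (by simp)).differentiableOn S3_null
  have hdense : Dense (g '' {x | ∑ i, x i * x i = 1})ᶜ :=
    Measure.dense_of_ae (measure_eq_zero_iff_ae_notMem.1 hnull)
  obtain ⟨c, hc, hc2⟩ := hdense.exists_dist_lt 0 (ε := 1/16) (by norm_num)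
  rw [dist_zero_left] at hc2
  have hdisj : Disjoint (range fun x : C => (x : S3).1) {x | ‖F x‖ ≤ 1/4} := by
    rw [Set.disjoint_left]
    rintro _ ⟨⟨x, hx⟩, rfl⟩ h
    simp only [mem_setOf_eq, hFC x hx] at h
    have h1 := (f x).2
    have h2 : ∀ i, (f x).1 i * (f x).1 i ≤ 1/16 := fun i => by
      have := (norm_le_pi_norm (f x).1 i).trans h
      rw [Real.norm_eq_abs, abs_le] at this
      nlinarith
    have := Finset.sum_le_sum (s := Finset.univ) fun i _ => h2 i
    rw [h1] at this
    norm_num at this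
  obtain ⟨u, hu0, hu1, hu⟩ := exists_continuous_zero_one_of_isClosed he.isClosed_range
    (isClosed_le (by fun_prop) (by fun_prop)) hdisj
  let H : (Fin 4 → ℝ) → (Fin 4 → ℝ) := fun x => F x + u x • (g x - c - F x)
  have hgc : Continuous g := hg.continuous
  have hH : Continuous H := by fun_prop
  have hne : ∀ x : S3, H x.1 ≠ 0 := by
    intro x hx
    by_cases hK : ‖F x.1‖ ≤ 1/4
    · have := hu1 hK
      simp only [H, this, Pi.one_apply, one_smul] at hx
      apply hc
      refine ⟨x.1, x.2, ?_⟩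
      have : g x.1 - c = 0 := by rw [← hx]; abel
      exact sub_eq_zero.1 this
    · have h1 : ‖u x.1 • (g x.1 - c - F x.1)‖ ≤ 1/8 := by
        rw [norm_smul, Real.norm_eq_abs, abs_of_nonneg (hu _).1]
        have h2 : ‖g x.1 - c - F x.1‖ ≤ 1/8 := by
          have h3 := hgF x.1
          rw [dist_eq_norm] at h3
          calc _ = ‖(g x.1 - F x.1) - c‖ := by congr 1; abel
            _ ≤ _ := norm_sub_le _ _
            _ ≤ _ := by linarith
        nlinarith [(hu x.1).1, (hu x.1).2, norm_nonneg (g x.1 - c - F x.1)]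
      have : F x.1 = - (u x.1 • (g x.1 - c - F x.1)) := eq_neg_of_add_eq_zero_left hx
      rw [this, norm_neg] at hK
      linarith
  have hpos : ∀ x : S3, 0 < ∑ i, H x.1 i * H x.1 i := by
    intro x
    obtain ⟨i, hi⟩ := Function.ne_iff.1 (hne x)
    exact Finset.sum_pos' (fun i _ => mul_self_nonneg _) ⟨i, Finset.mem_univ _, mul_self_pos.2 hi⟩
  refine ⟨fun x => ⟨fun i => H x.1 i / √(∑ i, H x.1 i * H x.1 i), ?_⟩, ?_, ?_⟩
  · have := hpos x
    simp only [div_mul_div_comm, Real.mul_self_sqrt this.le]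
    rw [← Finset.sum_div, div_self this.ne']
  · refine Continuous.subtype_mk (continuous_pi fun i => ?_) _
    refine Continuous.div (by fun_prop) (by fun_prop) fun x => (Real.sqrt_pos.2 (hpos x)).ne'
  · intro x hx
    have : H x.1 = (f x).1 := by
      have := hu0 ⟨⟨x, hx⟩, rfl⟩
      simp only [Pi.zero_apply] at this
      simp [H, this, hFC x hx]
    ext i
    simp only [this, (f x).2]
    simp

open Set Filter Topology in
theorem S3_equivariant {G : Type*} [Group G] [Finite G] (γ₁ γ₂ : G → S3 → S3)
    (h1one : ∀ x, γ₁ 1 x = x) (h1mul : ∀ g h x, γ₁ (g * h) x = γ₁ g (γ₁ h x))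
    (h1cont : ∀ g, Continuous (γ₁ g))
    (h2one : ∀ x, γ₂ 1 x = x) (h2mul : ∀ g h x, γ₂ (g * h) x = γ₂ g (γ₂ h x))
    (h2cont : ∀ g, Continuous (γ₂ g))
    (h1free : ∀ g : G, g ≠ 1 → ∀ x, γ₁ g x ≠ x) :
    ∃ φ : S3 → S3, Continuous φ ∧ ∀ g x, φ (γ₁ g x) = γ₂ g (φ x) := by
  classical
  have hcpt : CompactSpace S3 := by
    apply isCompact_iff_compactSpace.1
    refine Metric.isCompact_of_isClosed_isBounded (isClosed_eq (by fun_prop) (by fun_prop))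
      ((Metric.isBounded_closedBall (x := (0 : Fin 4 → ℝ)) (r := 1)).subset ?_)
    intro x (hx : ∑ i, x i * x i = 1)
    rw [mem_closedBall_zero_iff, pi_norm_le_iff_of_nonneg zero_le_one]
    intro i
    have := Finset.single_le_sum (s := Finset.univ) (f := fun i => x i * x i)
      (fun i _ => mul_self_nonneg _) (Finset.mem_univ i)
    rw [Real.norm_eq_abs, abs_le]
    constructor <;> nlinarith
  have hloc : ∀ x : S3, ∃ U ∈ 𝓝 x, IsClosed U ∧ ∀ g : G, g ≠ 1 → ∀ y ∈ U, γ₁ g y ∉ U := by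
    intro x
    have h1 : ∀ g : G, ∃ V ∈ 𝓝 x, g ≠ 1 → ∀ y ∈ V, γ₁ g y ∉ V := by
      intro g
      by_cases hg : g = 1
      · exact ⟨univ, univ_mem, fun h => (h hg).elim⟩
      obtain ⟨A, B, hA, hB, hxA, hxB, hd⟩ := t2_separation (h1free g hg x)
      refine ⟨B ∩ γ₁ g ⁻¹' A, (hB.inter (hA.preimage (h1cont g))).mem_nhds ⟨hxB, hxA⟩, ?_⟩
      intro _ y hy hy2
      exact Set.disjoint_left.1 hd hy.2 hy2.1
    choose V hV hV2 using h1
    obtain ⟨U, hU, hUc, hUV⟩ := exists_mem_nhds_isClosed_subset (Filter.iInter_mem.2 hV)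
    exact ⟨U, hU, hUc, fun g hg y hy hy2 =>
      hV2 g hg y (mem_iInter.1 (hUV hy) g) (mem_iInter.1 (hUV hy2) g)⟩
  choose U hU hUc hUd using hloc
  obtain ⟨t, ht⟩ := CompactSpace.elim_nhds_subcover U hU
  let O : S3 → Set S3 := fun x => ⋃ g : G, γ₁ g ⁻¹' U x
  have hOc : ∀ x, IsClosed (O x) := fun x =>
    isClosed_iUnion_of_finite fun g => (hUc x).preimage (h1cont g)
  have hOi : ∀ a g x, x ∈ O a → γ₁ g x ∈ O a := by
    intro a g x hx
    obtain ⟨k, hk⟩ := mem_iUnion.1 hx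
    refine mem_iUnion.2 ⟨k * g⁻¹, ?_⟩
    rw [mem_preimage, ← h1mul]
    simpa using hk
  have key : ∀ s : Finset S3, ∃ φ : S3 → S3, ContinuousOn φ (⋃ a ∈ s, O a) ∧
      ∀ g, ∀ x ∈ (⋃ a ∈ s, O a), φ (γ₁ g x) = γ₂ g (φ x) := by
    intro s
    induction s using Finset.induction_on with
    | empty => exact ⟨id, by simp, by simp⟩
    | insert a s ha ih =>
      obtain ⟨φ, hφ, hφe⟩ := ih
      have hAc : IsClosed (⋃ a ∈ s, O a) := isClosed_biUnion_finset fun i _ => hOc i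
      have hAi : ∀ g x, x ∈ (⋃ a ∈ s, O a) → γ₁ g x ∈ (⋃ a ∈ s, O a) := by
        intro g x hx
        simp only [mem_iUnion₂] at hx ⊢
        obtain ⟨b, hb, hx⟩ := hx
        exact ⟨b, hb, hOi b g x hx⟩
      rw [Finset.set_biUnion_insert, union_comm]
      generalize (⋃ a ∈ s, O a) = A at *
      obtain ⟨ψ, hψ, hψe⟩ := S3_extend (A ∩ U a) (hAc.inter (hUc a)) φ (hφ.mono inter_subset_left)
      let φ' : S3 → S3 := fun x => if x ∈ A then φ x else
        if h : ∃ g, γ₁ g x ∈ U a then γ₂ h.choose⁻¹ (ψ (γ₁ h.choose x)) else x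
      have e1 : ∀ x ∈ A, φ' x = φ x := fun x hx => if_pos hx
      have uniq : ∀ x g k, γ₁ g x ∈ U a → γ₁ k x ∈ U a → g = k := by
        intro x g k hg hk
        by_contra hne
        refine hUd a (k * g⁻¹) (fun h => hne (mul_inv_eq_one.1 h).symm) _ hg ?_
        rw [← h1mul]
        simpa using hk
      have e2 : ∀ x g, γ₁ g x ∈ U a → φ' x = γ₂ g⁻¹ (ψ (γ₁ g x)) := by
        intro x g hg
        by_cases hx : x ∈ A
        · rw [e1 x hx, hψe _ ⟨hAi g x hx, hg⟩, hφe g x hx, ← h2mul, inv_mul_cancel, h2one]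
        · have h : ∃ g, γ₁ g x ∈ U a := ⟨g, hg⟩
          have : h.choose = g := uniq x _ _ h.choose_spec hg
          simp only [φ', if_neg hx, dif_pos h, this]
      refine ⟨φ', ?_, ?_⟩
      · refine ContinuousOn.union_of_isClosed (hφ.congr e1) ?_ hAc (hOc a)
        refine (locallyFinite_of_finite _).continuousOn_iUnion
          (fun g => (hUc a).preimage (h1cont g)) fun g => ?_
        have : Continuous fun x => γ₂ g⁻¹ (ψ (γ₁ g x)) :=
          (h2cont _).comp (hψ.comp (h1cont g))
        exact this.continuousOn.congr fun x hx => e2 x g hx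
      · rintro g x (hx | hx)
        · rw [e1 x hx, e1 _ (hAi g x hx), hφe g x hx]
        · obtain ⟨k, hk⟩ := mem_iUnion.1 hx
          have hk' : γ₁ (k * g⁻¹) (γ₁ g x) = γ₁ k x := by
            rw [← h1mul]; simp
          rw [e2 x k hk, e2 _ (k * g⁻¹) (by rw [hk']; exact hk), hk', ← h2mul]
          simp
  obtain ⟨φ, hφ, hφe⟩ := key t
  have hall : (⋃ a ∈ t, O a) = univ := by
    refine eq_univ_of_univ_subset (fun x _ => ?_)
    have : x ∈ ⋃ a ∈ t, U a := by rw [ht]; trivial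
    simp only [mem_iUnion₂] at this ⊢
    obtain ⟨b, hb, hx⟩ := this
    exact ⟨b, hb, mem_iUnion.2 ⟨1, by rw [mem_preimage, h1one]; exact hx⟩⟩
  rw [hall] at hφ hφe
  exact ⟨φ, continuousOn_univ.1 hφ, fun g x => hφe g x trivial⟩

theorem equivariant_map_exists_iff_for_free_actions_on_S3
    {G : Type*} [Group G] [Finite G]
    {Z : Type*} [TopologicalSpace Z] [MulAction G Z]
    (hZcont : ∀ g : G, Continuous (fun z : Z => g • z))
    (γ₁ γ₂ : G → S3 → S3)
    (h1one : ∀ x, γ₁ 1 x = x) (h1mul : ∀ g h x, γ₁ (g * h) x = γ₁ g (γ₁ h x))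
    (h1cont : ∀ g, Continuous (γ₁ g))
    (h2one : ∀ x, γ₂ 1 x = x) (h2mul : ∀ g h x, γ₂ (g * h) x = γ₂ g (γ₂ h x))
    (h2cont : ∀ g, Continuous (γ₂ g))
    (h1free : ∀ g : G, g ≠ 1 → ∀ x, γ₁ g x ≠ x)
    (h2free : ∀ g : G, g ≠ 1 → ∀ x, γ₂ g x ≠ x) :
    (∃ f : S3 → Z, Continuous f ∧ ∀ (g : G) (x : S3), f (γ₁ g x) = g • f x) ↔
    (∃ f : S3 → Z, Continuous f ∧ ∀ (g : G) (x : S3), f (γ₂ g x) = g • f x) := by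
  constructor
  · rintro ⟨f, hf, hfe⟩
    obtain ⟨φ, hφ, hφe⟩ := S3_equivariant γ₂ γ₁ h2one h2mul h2cont h1one h1mul h1cont h2free
    exact ⟨f ∘ φ, hf.comp hφ, fun g x => by simp [hφe, hfe]⟩
  · rintro ⟨f, hf, hfe⟩
    obtain ⟨φ, hφ, hφe⟩ := S3_equivariant γ₁ γ₂ h1one h1mul h1cont h2one h2mul h2cont h1free
    exact ⟨f ∘ φ, hf.comp hφ, fun g x => by simp [hφe, hfe]⟩
end

section
/- Let G be a finite group acting freely and continuously on the 3-sphere S³, let V be a finite-dimensional real vector space with a linear G-action, and let 𝒜 and ℬ be two finite G-invariant families of linear subspaces of V which are weakly G-isomorphic. Then there exists a continuous G-equivariant map f : S³ → V ∖ ⋃𝒜 if and only if there exists a continuous G-equivariant map g : S³ → V ∖ ⋃ℬ. -/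
/-- Polar coordinates in the plane. -/
theorem aux_polar (a b : ℝ) : ∃ r t : ℝ, 0 ≤ r ∧ r ^ 2 = a ^ 2 + b ^ 2 ∧
    a = r * Real.cos t ∧ b = r * Real.sin t := by
  refine ⟨‖(⟨a, b⟩ : ℂ)‖, Complex.arg ⟨a, b⟩, norm_nonneg _, ?_, ?_, ?_⟩
  · rw [Complex.sq_norm, Complex.normSq_mk]; ring
  · rw [Complex.norm_mul_cos_arg]
  · rw [Complex.norm_mul_sin_arg]

/-- A smooth parametrisation of the 3-sphere by three angles. -/
noncomputable def auxParam (u : Fin 3 → ℝ) : Fin 4 → ℝ :=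
  ![Real.cos (u 0) * Real.cos (u 1), Real.cos (u 0) * Real.sin (u 1),
    Real.sin (u 0) * Real.cos (u 2), Real.sin (u 0) * Real.sin (u 2)]

theorem auxParam_contDiff : ContDiff ℝ 1 auxParam := by
  rw [contDiff_pi]
  intro i
  have h : ∀ j : Fin 3, ContDiff ℝ 1 (fun u : Fin 3 → ℝ => u j) := fun j => contDiff_apply ℝ ℝ j
  fin_cases i
  · exact ((h 0).cos).mul ((h 1).cos)
  · exact ((h 0).cos).mul ((h 1).sin)
  · exact ((h 0).sin).mul ((h 2).cos)
  · exact ((h 0).sin).mul ((h 2).sin)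

theorem auxParam_surj (x : S3) : ∃ u, auxParam u = x.1 := by
  obtain ⟨x, hx⟩ := x
  obtain ⟨r, a, hr, hr2, h0, h1⟩ := aux_polar (x 0) (x 1)
  obtain ⟨s, b, hs, hs2, h2, h3⟩ := aux_polar (x 2) (x 3)
  obtain ⟨q, t, hq, hq2, h4, h5⟩ := aux_polar r s
  have hq1 : q = 1 := by
    have : q ^ 2 = 1 := by
      rw [hq2, hr2, hs2]
      simp only [Fin.sum_univ_four] at hx
      nlinarith
    nlinarith
  subst hq1
  rw [one_mul] at h4 h5
  refine ⟨![t, a, b], ?_⟩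
  funext i
  fin_cases i
  · simp [auxParam, ← h4, ← h0]
  · simp [auxParam, ← h4, ← h1]
  · simp [auxParam, ← h5, ← h2]
  · simp [auxParam, ← h5, ← h3]

theorem aux_isClosed_S3 : IsClosed {x : Fin 4 → ℝ | ∑ i, x i * x i = 1} :=
  isClosed_eq (by fun_prop) continuous_const

instance auxCompact : CompactSpace S3 := by
  have : IsCompact {x : Fin 4 → ℝ | ∑ i, x i * x i = 1} := by
    refine Metric.isCompact_of_isClosed_isBounded aux_isClosed_S3 ?_
    refine (Metric.isBounded_closedBall (x := (0 : Fin 4 → ℝ)) (r := 1)).subset ?_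
    intro x hx
    rw [mem_closedBall_zero_iff, pi_norm_le_iff_of_nonneg zero_le_one]
    intro i
    have h1 : x i * x i ≤ ∑ j, x j * x j :=
      Finset.single_le_sum (f := fun j => x j * x j) (fun j _ => mul_self_nonneg _)
        (Finset.mem_univ i)
    rw [Set.mem_setOf_eq] at hx
    rw [hx] at h1
    rw [Real.norm_eq_abs, abs_le]
    constructor <;> nlinarith
  exact isCompact_iff_compactSpace.mp this

theorem aux_norm_ge (x : S3) : 1 / 2 ≤ ‖x.1‖ := by
  by_contra! hlt
  have h : ∀ i, x.1 i * x.1 i < 1 / 4 := by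
    intro i
    have h1 := (norm_le_pi_norm x.1 i).trans_lt hlt
    rw [Real.norm_eq_abs, abs_lt] at h1
    nlinarith
  have := x.2
  rw [Fin.sum_univ_four] at this
  linarith [h 0, h 1, h 2, h 3]

/-- A continuous nowhere zero map to ℝ⁴ can be normalised to a map to the sphere. -/
theorem aux_normalize {X : Type*} [TopologicalSpace X] (F : X → Fin 4 → ℝ) (hF : Continuous F)
    (h0 : ∀ x, F x ≠ 0) : ∃ H : X → S3, Continuous H ∧
      ∀ x, ∀ y : S3, F x = y.1 → H x = y := by
  have hpos : ∀ x, 0 < ∑ i, F x i * F x i := by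
    intro x
    obtain ⟨i, hi⟩ := Function.ne_iff.mp (h0 x)
    exact Finset.sum_pos' (fun j _ => mul_self_nonneg _)
      ⟨i, Finset.mem_univ i, mul_self_pos.mpr hi⟩
  have hc : Continuous fun x => Real.sqrt (∑ i, F x i * F x i) := by fun_prop
  refine ⟨fun x => ⟨fun i => F x i / Real.sqrt (∑ i, F x i * F x i), ?_⟩, ?_, ?_⟩
  · have := Real.mul_self_sqrt (hpos x).le
    have h2 : ∀ i, F x i / Real.sqrt (∑ i, F x i * F x i) * (F x i / Real.sqrt (∑ i, F x i * F x i))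
        = F x i * F x i / (∑ i, F x i * F x i) := by
      intro i
      rw [div_mul_div_comm, this]
    simp_rw [h2]
    rw [← Finset.sum_div]
    exact div_self (hpos x).ne'
  · refine Continuous.subtype_mk (continuous_pi fun i => ?_) _
    exact ((continuous_apply i).comp hF).div hc fun x => (Real.sqrt_pos.mpr (hpos x)).ne'
  · intro x y hxy
    apply Subtype.ext
    funext i
    simp [hxy, y.2]

/-- Since the 3-sphere is three-dimensional, a continuous map to the 3-sphere from a closed
subset of it extends to the whole sphere. -/
theorem aux_extend (A : Set S3) (hA : IsClosed A) (f : S3 → S3) (hf : ContinuousOn f A) :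
    ∃ H : S3 → S3, Continuous H ∧ ∀ x ∈ A, H x = f x := by
  have hemb : Topology.IsClosedEmbedding (fun x : A => x.1.1) :=
    (aux_isClosed_S3.isClosedEmbedding_subtypeVal).comp hA.isClosedEmbedding_subtypeVal
  have hfc : Continuous (fun x : A => (f x.1).1) :=
    continuous_subtype_val.comp (continuousOn_iff_continuous_restrict.mp hf)
  obtain ⟨F, hF⟩ := ContinuousMap.exists_extension' hemb (⟨_, hfc⟩ : C(A, Fin 4 → ℝ))
  have hFA : ∀ x ∈ A, F x.1 = (f x).1 := fun x hx => congrFun hF ⟨x, hx⟩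
  obtain ⟨P, hP, hPF, -⟩ := F.continuous.exists_contDiff_approx 1 (ε := fun _ => 1 / 8)
    continuous_const (fun _ => by norm_num)
  have hdense : Dense (Set.range (P ∘ auxParam))ᶜ :=
    ContDiff.dense_compl_range_of_finrank_lt_finrank
      (ContDiff.comp hP auxParam_contDiff) (by simp)
  obtain ⟨c, hc, hc0⟩ := hdense.exists_dist_lt (0 : Fin 4 → ℝ) (ε := 1 / 8) (by norm_num)
  rw [dist_zero_left] at hc0
  have hQ0 : ∀ x : S3, P x.1 - c ≠ 0 := by
    intro x h
    obtain ⟨u, hu⟩ := auxParam_surj x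
    exact hc ⟨u, by rw [Function.comp_apply, hu]; exact sub_eq_zero.mp h⟩
  have hQF : ∀ x : S3, ‖(P x.1 - c) - F x.1‖ < 1 / 4 := by
    intro x
    have h1 := hPF x.1
    rw [dist_eq_norm] at h1
    have h2 : (P x.1 - c) - F x.1 = (P x.1 - F x.1) - c := by abel
    rw [h2]
    linarith [norm_sub_le (P x.1 - F x.1) c]
  have hFc : Continuous fun x : S3 => F x.1 := F.continuous.comp continuous_subtype_val
  have hPc : Continuous fun x : S3 => P x.1 := hP.continuous.comp continuous_subtype_val
  obtain ⟨l, hl0, hl1, hl⟩ := exists_continuous_zero_one_of_isClosed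
    (s := {x : S3 | ‖F x.1‖ ≤ 1 / 4}) (t := A)
    (isClosed_le hFc.norm continuous_const) hA (by
      rw [Set.disjoint_left]
      intro x hx hxA
      rw [Set.mem_setOf_eq, hFA x hxA] at hx
      linarith [aux_norm_ge (f x)])
  obtain ⟨H, hH, hHe⟩ := aux_normalize
    (fun x : S3 => F x.1 + (1 - l x) • ((P x.1 - c) - F x.1))
    (by have := l.continuous; fun_prop) (by
      intro x hx
      by_cases hx4 : ‖F x.1‖ ≤ 1 / 4
      · have : l x = 0 := hl0 hx4
        rw [this] at hx
        apply hQ0 x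
        rw [← hx]
        simp
      · have h1 : F x.1 = -((1 - l x) • ((P x.1 - c) - F x.1)) := eq_neg_of_add_eq_zero_left hx
        apply hx4
        rw [h1, norm_neg, norm_smul, Real.norm_eq_abs, abs_of_nonneg (by linarith [(hl x).2])]
        nlinarith [hQF x, (hl x).1, (hl x).2, norm_nonneg ((P x.1 - c) - F x.1)])
  refine ⟨H, hH, fun x hx => hHe x _ ?_⟩
  have : l x = 1 := hl1 hx
  simp [this, hFA x hx]

/-- One step of the equivariant extension. -/
theorem aux_step {G : Type*} [Group G] [Finite G] (γ γ' : G → S3 → S3)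
    (hone : ∀ x, γ 1 x = x) (hmul : ∀ g h x, γ (g * h) x = γ g (γ h x))
    (hcont : ∀ g, Continuous (γ g))
    (hmul' : ∀ g h x, γ' (g * h) x = γ' g (γ' h x))
    (hone' : ∀ x, γ' 1 x = x)
    (hcont' : ∀ g, Continuous (γ' g))
    (A : Set S3) (hA : IsClosed A) (hAinv : ∀ g, ∀ x ∈ A, γ g x ∈ A)
    (h : S3 → S3) (hc : ContinuousOn h A) (heq : ∀ g, ∀ x ∈ A, h (γ g x) = γ' g (h x))
    (B : Set S3) (hB : IsClosed B) (hBB : ∀ g : G, g ≠ 1 → ∀ x ∈ B, ∀ y ∈ B, γ g x ≠ y) :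
    ∃ (A' : Set S3) (h' : S3 → S3), IsClosed A' ∧ (∀ g, ∀ x ∈ A', γ g x ∈ A') ∧
      ContinuousOn h' A' ∧ (∀ g, ∀ x ∈ A', h' (γ g x) = γ' g (h' x)) ∧ A ⊆ A' ∧ B ⊆ A' := by
  classical
  obtain ⟨H, hH, hHA⟩ := aux_extend A hA h hc
  have huniq : ∀ g k x, γ g⁻¹ x ∈ B → γ k⁻¹ x ∈ B → g = k := by
    intro g k x hg hk
    by_contra hne
    refine hBB (k⁻¹ * g) ?_ _ hg _ hk ?_
    · intro h1
      exact hne (inv_mul_eq_one.mp h1).symm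
    · rw [← hmul]; simp
  have hshift : ∀ g k x, γ (g * k)⁻¹ (γ g x) = γ k⁻¹ x := by
    intro g k x
    rw [← hmul]; simp
  let h' : S3 → S3 := fun x => if hx : ∃ g, γ g⁻¹ x ∈ B then
    γ' hx.choose (H (γ hx.choose⁻¹ x)) else H x
  have h1 : ∀ g x, γ g⁻¹ x ∈ B → h' x = γ' g (H (γ g⁻¹ x)) := by
    intro g x hx
    have hex : ∃ g, γ g⁻¹ x ∈ B := ⟨g, hx⟩
    have : hex.choose = g := huniq _ _ x hex.choose_spec hx
    simp only [h', dif_pos hex]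
    rw [this]
  have h2 : ∀ x ∈ A, h' x = h x := by
    intro x hx
    by_cases hex : ∃ g, γ g⁻¹ x ∈ B
    · obtain ⟨g, hg⟩ := hex
      rw [h1 g x hg, hHA _ (hAinv _ _ hx), heq _ _ hx, ← hmul']
      simp [hone']
    · simp only [h', dif_neg hex]
      exact hHA x hx
  have hcl : ∀ g, IsClosed {x | γ g⁻¹ x ∈ B} := fun g => hB.preimage (hcont _)
  refine ⟨A ∪ ⋃ g, {x | γ g⁻¹ x ∈ B}, h', hA.union (isClosed_iUnion_of_finite hcl),
    ?_, ?_, ?_, Set.subset_union_left, ?_⟩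
  · rintro g x (hx | hx)
    · exact Or.inl (hAinv g x hx)
    · obtain ⟨k, hk⟩ := Set.mem_iUnion.mp hx
      refine Or.inr (Set.mem_iUnion.mpr ⟨g * k, ?_⟩)
      rw [Set.mem_setOf_eq, hshift]
      exact hk
  · refine ContinuousOn.union_of_isClosed (hc.congr h2) ?_ hA (isClosed_iUnion_of_finite hcl)
    refine (locallyFinite_of_finite _).continuousOn_iUnion hcl fun g => ?_
    exact ((hcont' g).comp (hH.comp (hcont g⁻¹))).continuousOn.congr fun x hx => h1 g x hx
  · rintro g x (hx | hx)
    · rw [h2 x hx, h2 _ (hAinv g x hx), heq g x hx]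
    · obtain ⟨k, hk⟩ := Set.mem_iUnion.mp hx
      rw [h1 k x hk, h1 (g * k) (γ g x) (by rw [hshift]; exact hk), hshift, hmul']
  · intro x hx
    refine Or.inr (Set.mem_iUnion.mpr ⟨1, ?_⟩)
    simpa [hone] using hx

/-- Between any two continuous actions of a finite group on the 3-sphere, the first of them
free, there is a continuous equivariant map. -/
theorem aux_exists_equivariant {G : Type*} [Group G] [Finite G] (γ γ' : G → S3 → S3)
    (hone : ∀ x, γ 1 x = x) (hmul : ∀ g h x, γ (g * h) x = γ g (γ h x))
    (hcont : ∀ g, Continuous (γ g))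
    (hfree : ∀ g : G, g ≠ 1 → ∀ x, γ g x ≠ x)
    (hone' : ∀ x, γ' 1 x = x)
    (hmul' : ∀ g h x, γ' (g * h) x = γ' g (γ' h x))
    (hcont' : ∀ g, Continuous (γ' g)) :
    ∃ h : S3 → S3, Continuous h ∧ ∀ g x, h (γ g x) = γ' g (h x) := by
  classical
  have hloc : ∀ x : S3, ∃ B ∈ nhds x, IsClosed B ∧
      ∀ g : G, g ≠ 1 → ∀ y ∈ B, ∀ z ∈ B, γ g y ≠ z := by
    intro x
    have hev : ∀ᶠ p : S3 × S3 in nhds x ×ˢ nhds x, ∀ g : G, g ≠ 1 → γ g p.1 ≠ p.2 := by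
      rw [← nhds_prod_eq, Filter.eventually_all]
      intro g
      by_cases hg : g = 1
      · simp [hg]
      · have hopen : IsOpen {p : S3 × S3 | γ g p.1 ≠ p.2} :=
          isOpen_ne_fun ((hcont g).comp continuous_fst) continuous_snd
        filter_upwards [hopen.mem_nhds (hfree g hg x)] with p hp _
        exact hp
    obtain ⟨B, ⟨hBn, hBc⟩, hB⟩ := ((closed_nhds_basis x).prod_self.eventually_iff).mp hev
    exact ⟨B, hBn, hBc, fun g hg y hy z hz => @hB (y, z) ⟨hy, hz⟩ g hg⟩
  choose B hBn hBc hB using hloc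
  obtain ⟨t, ht⟩ := CompactSpace.elim_nhds_subcover B hBn
  have key : ∀ s : Finset S3, ∃ (A : Set S3) (h : S3 → S3), IsClosed A ∧
      (∀ g, ∀ x ∈ A, γ g x ∈ A) ∧ ContinuousOn h A ∧
      (∀ g, ∀ x ∈ A, h (γ g x) = γ' g (h x)) ∧ ∀ x ∈ s, B x ⊆ A := by
    intro s
    induction s using Finset.induction_on with
    | empty => exact ⟨∅, id, isClosed_empty, by simp, by simp, by simp, by simp⟩
    | insert a s _ ih =>
      obtain ⟨A, h, hA, hinv, hc, heq, hs⟩ := ih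
      obtain ⟨A', h', hA', hinv', hc', heq', hsub, hBsub⟩ :=
        aux_step γ γ' hone hmul hcont hmul' hone' hcont' A hA hinv h hc heq (B a) (hBc a) (hB a)
      refine ⟨A', h', hA', hinv', hc', heq', fun x hx => ?_⟩
      rcases Finset.mem_insert.mp hx with rfl | hx
      · exact hBsub
      · exact (hs x hx).trans hsub
  obtain ⟨A, h, -, -, hc, heq, hs⟩ := key t
  have hA : A = Set.univ := by
    rw [Set.eq_univ_iff_forall]
    intro x
    have hx : x ∈ ⋃ y ∈ t, B y := by rw [ht]; trivial
    obtain ⟨y, hy, hxy⟩ := Set.mem_iUnion₂.mp hx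
    exact hs y hy hxy
  subst hA
  exact ⟨h, continuousOn_univ.mp hc, fun g x => heq g x trivial⟩

/-- One direction of the main theorem. -/
theorem aux_direction
    {G : Type*} [Group G] [Finite G] (γ : G → S3 → S3)
    (hone : ∀ x, γ 1 x = x) (hmul : ∀ g h x, γ (g * h) x = γ g (γ h x))
    (hcont : ∀ g, Continuous (γ g))
    (hfree : ∀ g : G, g ≠ 1 → ∀ x, γ g x ≠ x)
    (d : ℕ) (ρ : G →* ((Fin d → ℝ) ≃ₗ[ℝ] (Fin d → ℝ)))
    (𝒜 ℬ : Set (Submodule ℝ (Fin d → ℝ)))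
    (C : (Fin d → ℝ) ≃ₗ[ℝ] (Fin d → ℝ)) (θ : G ≃* G)
    (hC : ∀ (g : G) (x : Fin d → ℝ), C (ρ g x) = ρ (θ g) (C x))
    (hAB : ∀ K ∈ ℬ, ∃ L ∈ 𝒜, ∀ x, C x ∈ K → x ∈ L)
    (hex : ∃ f : S3 → (Fin d → ℝ), Continuous f ∧
      (∀ (g : G) (x : S3), f (γ g x) = ρ g (f x)) ∧
      (∀ x : S3, ∀ K ∈ 𝒜, f x ∉ K)) :
    (∃ f : S3 → (Fin d → ℝ), Continuous f ∧
      (∀ (g : G) (x : S3), f (γ g x) = ρ g (f x)) ∧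
      (∀ x : S3, ∀ K ∈ ℬ, f x ∉ K)) := by
  obtain ⟨f, hf, hfe, hfA⟩ := hex
  obtain ⟨h, hh, hhe⟩ := aux_exists_equivariant γ (fun g => γ (θ.symm g)) hone hmul hcont hfree
    (by simp [hone]) (by simp [hmul]) (fun g => hcont _)
  have hCc : Continuous C := LinearMap.continuous_of_finiteDimensional C.toLinearMap
  refine ⟨fun x => C (f (h x)), hCc.comp (hf.comp hh), ?_, ?_⟩
  · intro g x
    beta_reduce
    rw [hhe, hfe, hC]
    simp
  · intro x K hK hx
    obtain ⟨L, hL, hLK⟩ := hAB K hK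
    exact hfA (h x) L hL (hLK _ hx)

theorem equivariant_map_complement_iff_of_weakly_isomorphic_arrangements
    {G : Type*} [Group G] [Finite G] (γ : G → S3 → S3)
    (hone : ∀ x, γ 1 x = x) (hmul : ∀ g h x, γ (g * h) x = γ g (γ h x))
    (hcont : ∀ g, Continuous (γ g))
    (hfree : ∀ g : G, g ≠ 1 → ∀ x, γ g x ≠ x)
    (d : ℕ) (ρ : G →* ((Fin d → ℝ) ≃ₗ[ℝ] (Fin d → ℝ)))
    (𝒜 ℬ : Set (Submodule ℝ (Fin d → ℝ)))
    (hAfin : 𝒜.Finite) (hBfin : ℬ.Finite)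
    (hAinv : ∀ (g : G), ∀ K ∈ 𝒜, K.map (ρ g).toLinearMap ∈ 𝒜)
    (hBinv : ∀ (g : G), ∀ K ∈ ℬ, K.map (ρ g).toLinearMap ∈ ℬ)
    -- 𝒜 and ℬ are weakly G-isomorphic:
    (hweak : ∃ C : (Fin d → ℝ) ≃ₗ[ℝ] (Fin d → ℝ), ∃ θ : G ≃* G,
      (∀ (g : G) (x : Fin d → ℝ), C (ρ g x) = ρ (θ g) (C x)) ∧
      (∀ K : Submodule ℝ (Fin d → ℝ), K ∈ 𝒜 ↔ K.map C.toLinearMap ∈ ℬ)) :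
    (∃ f : S3 → (Fin d → ℝ), Continuous f ∧
      (∀ (g : G) (x : S3), f (γ g x) = ρ g (f x)) ∧
      (∀ x : S3, ∀ K ∈ 𝒜, f x ∉ K)) ↔
    (∃ f : S3 → (Fin d → ℝ), Continuous f ∧
      (∀ (g : G) (x : S3), f (γ g x) = ρ g (f x)) ∧
      (∀ x : S3, ∀ K ∈ ℬ, f x ∉ K)) := by
  obtain ⟨C, θ, hC, hAB⟩ := hweak
  constructor
  · refine aux_direction γ hone hmul hcont hfree d ρ 𝒜 ℬ C θ hC ?_
    intro K hK
    refine ⟨K.comap C.toLinearMap, ?_, fun x hx => hx⟩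
    rw [hAB, Submodule.map_comap_eq_of_surjective C.surjective]
    exact hK
  · refine aux_direction γ hone hmul hcont hfree d ρ ℬ 𝒜 C.symm θ.symm ?_ ?_
    · intro g x
      rw [LinearEquiv.symm_apply_eq, hC]
      simp
    · intro K hK
      refine ⟨K.map C.toLinearMap, (hAB K).mp hK, fun x hx => ?_⟩
      exact ⟨C.symm x, hx, C.apply_symm_apply x⟩
end
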